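/- arXiv:2003.05338 — 2 statements merged into one kernel-verified Lean document; each statement's English description precedes it below -/
import Mathlib

section
/- Let X and Y be Polish spaces, t ≥ 1, and let C : X × P_t(Y) → ℝ ∪ {+∞} satisfy property (A). Then for every μ ∈ P(X) and ν ∈ P_t(Y) the infimum defining the weak transport value V_C(μ,ν) = inf_{π ∈ Π(μ,ν)} ∫_X C(x,π_x) μ(dx) is attained by some coupling π* ∈ Π(μ,ν). -/
open MeasureTheory ProbabilityTheory ENNReal NNReal

noncomputable section

/-- A probability measure has finite `t`-th moment. -/
def MemPt {Z : Type*} [MetricSpace Z] [MeasurableSpace Z] (t : ℝ)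
    (p : ProbabilityMeasure Z) : Prop :=
  ∃ z₀ : Z, Integrable (fun z => dist z z₀ ^ t) (p : Measure Z)

/-- The class `Φ_t` of continuous functions with growth of order at most `t`. -/
def PhiT (t : ℝ) (Y : Type*) [MetricSpace Y] : Set (Y → ℝ) :=
  {g | Continuous g ∧ ∃ (K : ℝ) (y₀ : Y), ∀ y, |g y| ≤ K * (1 + dist y y₀ ^ t)}

/-- The space `𝒫_t(Y)` of probability measures with finite `t`-th moment. -/
def PtSpace (t : ℝ) (Y : Type*) [MetricSpace Y] [MeasurableSpace Y] : Type _ :=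
  {p : ProbabilityMeasure Y // MemPt t p}

/-- The `t`-Wasserstein topology on `𝒫_t(Y)`: the initial topology for the maps
`p ↦ ∫ g dp`, `g ∈ Φ_t(Y)`. -/
noncomputable instance (t : ℝ) (Y : Type*) [MetricSpace Y] [MeasurableSpace Y] :
    TopologicalSpace (PtSpace t Y) :=
  ⨅ g ∈ PhiT t Y,
    TopologicalSpace.induced
      (fun p : PtSpace t Y => ∫ y, g y ∂((p.1 : Measure Y))) inferInstance

variable {X Y : Type*} [MetricSpace X] [PolishSpace X] [MeasurableSpace X] [BorelSpace X]
  [MetricSpace Y] [PolishSpace Y] [MeasurableSpace Y] [BorelSpace Y] [Nonempty Y]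

/-- `π` is a coupling of `μ` and `ν`. -/
def IsCoupling (μ : ProbabilityMeasure X) (ν : ProbabilityMeasure Y)
    (π : ProbabilityMeasure (X × Y)) : Prop :=
  (π : Measure (X × Y)).map Prod.fst = (μ : Measure X) ∧
    (π : Measure (X × Y)).map Prod.snd = (ν : Measure Y)

/-- The disintegration `x ↦ π_x` of a coupling with respect to its first marginal,
as a map into probability measures. -/
noncomputable def disint (π : ProbabilityMeasure (X × Y)) (x : X) : ProbabilityMeasure Y :=
  ⟨(π : Measure (X × Y)).condKernel x, inferInstance⟩

/-- The weak transport cost `∫ C(x, π_x) μ(dx)` of a coupling `π`. -/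
noncomputable def weakCost (C : X → ProbabilityMeasure Y → ℝ≥0∞)
    (μ : ProbabilityMeasure X) (π : ProbabilityMeasure (X × Y)) : ℝ≥0∞ :=
  ∫⁻ x, C x (disint π x) ∂(μ : Measure X)

open Filter Topology

set_option linter.unusedSectionVars false

section HatFunctions

variable {Z : Type*} [MetricSpace Z] [TopologicalSpace.SeparableSpace Z] [Nonempty Z]

/-- The hat functions `y ↦ (q - k d(y, zᵢ))⁺` around the points `zᵢ` of a dense sequence. -/
def hat (j : ℚ × ℕ × ℕ) (y : Z) : ℝ≥0 :=
  Real.toNNReal j.1 - j.2.1 * nndist y (TopologicalSpace.denseSeq Z j.2.2)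

/-- Finite suprema of hat functions. -/
def hatSup (s : Finset (ℚ × ℕ × ℕ)) (y : Z) : ℝ≥0 :=
  s.sup fun j => hat j y

lemma continuous_hat (j : ℚ × ℕ × ℕ) : Continuous (hat (Z := Z) j) := by
  unfold hat; fun_prop

lemma continuous_hatSup (s : Finset (ℚ × ℕ × ℕ)) : Continuous (hatSup (Z := Z) s) :=
  Continuous.finset_sup_apply fun j _ => continuous_hat j

lemma exists_hat_between {f : Z → ℝ≥0} (hf : Continuous f) {y : Z} {a : ℝ≥0} (ha : a < f y) :
    ∃ j, (∀ z, hat j z ≤ f z) ∧ a < hat j y := by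
  obtain ⟨q, -, haq, hqf⟩ := (NNReal.lt_iff_exists_rat_btwn _ _).1 ha
  obtain ⟨δ, hδ, hball⟩ := Metric.eventually_nhds_iff.1
    (hf.continuousAt.eventually (lt_mem_nhds hqf) : ∀ᶠ z in 𝓝 y, Real.toNNReal q < f z)
  obtain ⟨k, hk⟩ := exists_nat_gt (2 * (q : ℝ) / δ)
  have hk0 : (0 : ℝ) < (k : ℝ) + 1 := by positivity
  have haq' : (a : ℝ) < q := Real.lt_toNNReal_iff_coe_lt.1 haq
  have hε : 0 < min (δ / 2) (((q : ℝ) - a) / (k + 1)) :=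
    lt_min (by positivity) (div_pos (by linarith) hk0)
  obtain ⟨i, hi⟩ := (TopologicalSpace.denseRange_denseSeq Z).exists_mem_open
    Metric.isOpen_ball ⟨y, Metric.mem_ball_self hε⟩
  rw [Metric.mem_ball, dist_comm, lt_min_iff, lt_div_iff₀ hk0] at hi
  have hq0 : (0 : ℝ) ≤ q := a.2.trans haq'.le
  refine ⟨(q, k, i), fun z => ?_, ?_⟩
  · rcases lt_or_ge (dist z y) δ with hz | hz
    · exact tsub_le_self.trans (hball hz).le
    · have hdist : δ / 2 ≤ dist z (TopologicalSpace.denseSeq Z i) := by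
        linarith [dist_triangle z (TopologicalSpace.denseSeq Z i) y,
          dist_comm y (TopologicalSpace.denseSeq Z i)]
      have hle : (q : ℝ) ≤ k * dist z (TopologicalSpace.denseSeq Z i) := by
        rw [div_lt_iff₀ hδ] at hk
        have hk' : (0 : ℝ) ≤ k := by positivity
        nlinarith
      have hzero : hat (q, k, i) z = 0 := by
        refine tsub_eq_zero_of_le (Real.toNNReal_le_iff_le_coe.2 ?_)
        simpa using hle
      simp [hzero]
  · refine lt_tsub_iff_right.2 (NNReal.coe_lt_coe.1 ?_)
    have := dist_nonneg (x := y) (y := TopologicalSpace.denseSeq Z i)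
    push_cast
    rw [Real.coe_toNNReal _ hq0]
    nlinarith [hi.2]

lemma hatSup_union (s₁ s₂ : Finset (ℚ × ℕ × ℕ)) (y : Z) :
    hatSup (s₁ ∪ s₂) y = hatSup s₁ y ⊔ hatSup s₂ y :=
  Finset.sup_union

lemma hatSup_one (y : Z) : hatSup {((1 : ℚ), 0, 0)} y = 1 := by
  simp [hatSup, hat]

variable [MeasurableSpace Z] [BorelSpace Z]

lemma lintegral_eq_iSup_hatSup {f : Z → ℝ≥0} (hf : Continuous f) (m : Measure Z) :
    ∫⁻ y, f y ∂m =
      ⨆ s : {s : Finset (ℚ × ℕ × ℕ) // ∀ z : Z, hatSup s z ≤ f z}, ∫⁻ y, hatSup s.1 y ∂m := by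
  rw [← lintegral_iSup_directed (f := fun (s : {s : Finset (ℚ × ℕ × ℕ) //
      ∀ z : Z, hatSup s z ≤ f z}) y => (hatSup s.1 y : ℝ≥0∞))
    (fun s => (continuous_hatSup s.1).measurable.coe_nnreal_ennreal.aemeasurable)]
  · refine lintegral_congr fun y => le_antisymm (le_of_forall_lt fun c hc => ?_)
      (iSup_le fun s => ENNReal.coe_le_coe.2 (s.2 y))
    lift c to ℝ≥0 using hc.ne_top
    obtain ⟨j, hj, hcj⟩ := exists_hat_between hf (ENNReal.coe_lt_coe.1 hc)
    refine (ENNReal.coe_lt_coe.2 hcj).trans_le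
      (le_iSup_of_le ⟨{j}, fun z => by simpa [hatSup] using hj z⟩ (by simp [hatSup]))
  · intro s₁ s₂
    refine ⟨⟨s₁.1 ∪ s₂.1, fun z => ?_⟩, fun y => ?_, fun y => ?_⟩
    · rw [hatSup_union]; exact sup_le (s₁.2 z) (s₂.2 z)
    · simp [hatSup_union]
    · simp [hatSup_union]

lemma eventually_lt_lintegral_of_hatSup {α : Type*} {L : Filter α} {ms : α → Measure Z}
    {m : Measure Z} (h : ∀ s : Finset (ℚ × ℕ × ℕ),
      Tendsto (fun i => ∫⁻ y, hatSup s y ∂ms i) L (𝓝 (∫⁻ y, hatSup s y ∂m)))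
    {f : Z → ℝ≥0} (hf : Continuous f) {a : ℝ≥0∞} (ha : a < ∫⁻ y, f y ∂m) :
    ∀ᶠ i in L, a < ∫⁻ y, f y ∂ms i := by
  rw [lintegral_eq_iSup_hatSup hf, lt_iSup_iff] at ha
  obtain ⟨s, hs⟩ := ha
  filter_upwards [(h s.1).eventually (lt_mem_nhds hs)] with i hi
  exact hi.trans_le (lintegral_mono fun y => ENNReal.coe_le_coe.2 (s.2 y))

/-- The integrals of the countably many functions `hatSup s` determine convergence of finite
measures. -/
lemma tendsto_finiteMeasure_of_hatSup {α : Type*} {L : Filter α} {ms : α → FiniteMeasure Z}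
    {m : FiniteMeasure Z} (h : ∀ s : Finset (ℚ × ℕ × ℕ),
      Tendsto (fun i => ∫⁻ y, hatSup s y ∂(ms i : Measure Z)) L
        (𝓝 (∫⁻ y, hatSup s y ∂(m : Measure Z)))) :
    Tendsto ms L (𝓝 m) := by
  rw [FiniteMeasure.tendsto_iff_forall_lintegral_tendsto]
  intro f
  have hmass : Tendsto (fun i => (ms i : Measure Z) Set.univ) L (𝓝 ((m : Measure Z) Set.univ)) := by
    simpa [hatSup_one] using h {((1 : ℚ), 0, 0)}
  obtain ⟨c, hc⟩ : ∃ c : ℝ≥0, ∀ y, f y ≤ c := ⟨nndist f 0, fun y => by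
    exact BoundedContinuousFunction.NNReal.upper_bound f y⟩
  have hsplit (m : FiniteMeasure Z) : ∫⁻ y, f y ∂(m : Measure Z)
      + ∫⁻ y, (c - f y : ℝ≥0) ∂(m : Measure Z) = c * (m : Measure Z) Set.univ := by
    rw [← lintegral_add_left f.continuous.measurable.coe_nnreal_ennreal, ← lintegral_const]
    refine lintegral_congr fun y => ?_
    rw [← ENNReal.coe_add, add_tsub_cancel_of_le (hc y)]
  refine tendsto_order.2 ⟨fun a ha => eventually_lt_lintegral_of_hatSup h f.continuous ha,
    fun b hb => ?_⟩
  have hcmass : Tendsto (fun i => (c : ℝ≥0∞) * (ms i : Measure Z) Set.univ) L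
      (𝓝 (c * (m : Measure Z) Set.univ)) :=
    ENNReal.Tendsto.const_mul hmass (Or.inr ENNReal.coe_ne_top)
  have hfin : ∫⁻ y, (c - f y : ℝ≥0) ∂(m : Measure Z) ≠ ∞ := by
    refine ne_top_of_le_ne_top ?_ (le_add_self.trans (hsplit m).le)
    exact ENNReal.mul_ne_top ENNReal.coe_ne_top (measure_ne_top _ _)
  rcases eq_or_ne (∫⁻ y, (c - f y : ℝ≥0) ∂(m : Measure Z)) 0 with h0 | h0
  · have hlt : (c : ℝ≥0∞) * (m : Measure Z) Set.univ < b := by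
      rwa [← hsplit m, h0, add_zero]
    filter_upwards [hcmass.eventually (gt_mem_nhds hlt)] with i hi
    exact (le_self_add.trans (hsplit (ms i)).le).trans_lt hi
  · set G := ∫⁻ y, (c - f y : ℝ≥0) ∂(m : Measure Z)
    have hev : ∀ᶠ a in 𝓝[<] G, (c : ℝ≥0∞) * (m : Measure Z) Set.univ < b + a := by
      have hcont : Continuous fun a : ℝ≥0∞ => b + a := by fun_prop
      refine nhdsWithin_le_nhds ((hcont.tendsto G).eventually (lt_mem_nhds ?_))
      rw [← hsplit m]
      exact ENNReal.add_lt_add_right hfin hb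
    have : (𝓝[<] G).NeBot := nhdsLT_neBot_of_exists_lt ⟨0, pos_iff_ne_zero.2 h0⟩
    obtain ⟨a, hab, haG⟩ := (hev.and self_mem_nhdsWithin).exists
    have hcont : Continuous fun y => c - f y := by fun_prop
    filter_upwards [hcmass.eventually (gt_mem_nhds hab),
      eventually_lt_lintegral_of_hatSup h hcont haG] with i hi hai
    rw [← hsplit (ms i)] at hi
    exact lt_of_add_lt_add_right (hi.trans_le (add_le_add_right hai.le b))

end HatFunctions

section Weight

variable {Z : Type*} [MetricSpace Z]

/-- The weight `y ↦ 1 + d(y, y₀) ^ t`. -/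
def weight (t : ℝ) (y₀ y : Z) : ℝ≥0 := 1 + nndist y y₀ ^ t

lemma continuous_weight {t : ℝ} (ht : 1 ≤ t) (y₀ : Z) : Continuous (weight t y₀) := by
  have h0 : 0 ≤ t := by linarith
  unfold weight
  exact continuous_const.add ((NNReal.continuous_rpow_const h0).comp (by fun_prop))

lemma one_le_weight (t : ℝ) (y₀ y : Z) : 1 ≤ weight t y₀ y := le_self_add

lemma coe_weight (t : ℝ) (y₀ y : Z) : (weight t y₀ y : ℝ) = 1 + dist y y₀ ^ t := by
  simp [weight]

lemma exists_weight_le {t : ℝ} (ht : 1 ≤ t) (y₀ y₁ : Z) :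
    ∃ K : ℝ≥0, ∀ y, weight t y₁ y ≤ K * weight t y₀ y := by
  refine ⟨1 + 2 ^ (t - 1) * (1 + nndist y₀ y₁ ^ t), fun y => ?_⟩
  have h1 : nndist y y₁ ^ t ≤ 2 ^ (t - 1) * (nndist y y₀ ^ t + nndist y₀ y₁ ^ t) :=
    (NNReal.rpow_le_rpow (nndist_triangle y y₀ y₁) (by linarith)).trans
      (NNReal.rpow_add_le_mul_rpow_add_rpow _ _ ht)
  have key : ∀ a b c : ℝ≥0, 1 + c * (a + b) ≤ (1 + c * (1 + b)) * (1 + a) := fun a b c => by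
    have : (1 + c * (1 + b)) * (1 + a) = (1 + c * (a + b)) + (a + c + c * b * a) := by ring
    rw [this]; exact le_self_add
  exact (add_le_add_right h1 1).trans (key _ _ _)

variable [MeasurableSpace Z] [BorelSpace Z]

lemma memPt_iff {t : ℝ} (ht : 1 ≤ t) (y₀ : Z) (p : ProbabilityMeasure Z) :
    MemPt t p ↔ ∫⁻ y, weight t y₀ y ∂(p : Measure Z) ≠ ∞ := by
  have hint (y₁ : Z) : Integrable (fun y => (weight t y₁ y : ℝ)) (p : Measure Z) ↔
      ∫⁻ y, weight t y₁ y ∂(p : Measure Z) ≠ ∞ := by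
    have := (continuous_weight ht y₁).aestronglyMeasurable (μ := (p : Measure Z))
    rw [Integrable, and_iff_right (by fun_prop), hasFiniteIntegral_iff_ofNNReal, lt_top_iff_ne_top]
  refine ⟨fun ⟨y₁, h⟩ => ?_, fun h => ⟨y₀, ?_⟩⟩
  · have h1 : ∫⁻ y, weight t y₁ y ∂(p : Measure Z) ≠ ∞ := by
      rw [← hint]
      simpa only [coe_weight, Pi.add_def] using (integrable_const (1 : ℝ)).add h
    obtain ⟨K, hK⟩ := exists_weight_le ht y₁ y₀
    refine ne_top_of_le_ne_top (ENNReal.mul_ne_top (ENNReal.coe_ne_top (r := K)) h1) ?_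
    rw [← lintegral_const_mul' _ _ ENNReal.coe_ne_top]
    exact lintegral_mono fun y => by
      rw [← ENNReal.coe_mul]
      exact ENNReal.coe_le_coe.2 (hK y)
  · have := ((hint y₀).2 h).sub (integrable_const (1 : ℝ))
    simpa [coe_weight, Pi.sub_def] using this

/-- The finite measure `(1 + d(·, y₀) ^ t) p`. -/
def weighted {t : ℝ} (ht : 1 ≤ t) (y₀ : Z) (p : PtSpace t Z) : FiniteMeasure Z :=
  ⟨(p.1 : Measure Z).withDensity fun y => weight t y₀ y,
    isFiniteMeasure_withDensity ((memPt_iff ht y₀ p.1).1 p.2)⟩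

lemma lintegral_weighted {t : ℝ} (ht : 1 ≤ t) (y₀ : Z) (p : PtSpace t Z) {f : Z → ℝ≥0∞}
    (hf : Measurable f) :
    ∫⁻ y, f y ∂(weighted ht y₀ p : Measure Z) = ∫⁻ y, weight t y₀ y * f y ∂(p.1 : Measure Z) :=
  lintegral_withDensity_eq_lintegral_mul _
    (continuous_weight ht y₀).measurable.coe_nnreal_ennreal hf

lemma integral_eq_integral_weighted {t : ℝ} (ht : 1 ≤ t) (y₀ : Z) (p : PtSpace t Z) (g : Z → ℝ) :
    ∫ y, g y ∂(p.1 : Measure Z) =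
      ∫ y, (weight t y₀ y : ℝ)⁻¹ * g y ∂(weighted ht y₀ p : Measure Z) := by
  change _ = ∫ y, _ ∂((p.1 : Measure Z).withDensity fun y => weight t y₀ y)
  rw [integral_withDensity_eq_integral_smul (continuous_weight ht y₀).measurable]
  refine integral_congr_ae (ae_of_all _ fun y => ?_)
  have : (weight t y₀ y : ℝ) ≠ 0 := by
    have := one_le_weight t y₀ y
    positivity
  simp [NNReal.smul_def, this]

lemma tendsto_ptSpace_of_weighted {t : ℝ} (ht : 1 ≤ t) (y₀ : Z) {α : Type*} {L : Filter α}
    {ps : α → PtSpace t Z} {p : PtSpace t Z}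
    (h : Tendsto (fun i => weighted ht y₀ (ps i)) L (𝓝 (weighted ht y₀ p))) :
    Tendsto ps L (𝓝 p) := by
  simp only [nhds_iInf, nhds_induced, tendsto_iInf, tendsto_comap_iff, Function.comp_def]
  rintro g ⟨hg, K, y₁, hK⟩
  obtain ⟨K', hK'⟩ := exists_weight_le ht y₀ y₁
  have hpos (y : Z) : (0 : ℝ) < weight t y₀ y :=
    zero_lt_one.trans_le (NNReal.coe_le_coe.2 (one_le_weight t y₀ y))
  have hcont : Continuous fun y => (weight t y₀ y : ℝ)⁻¹ * g y :=
    ((NNReal.continuous_coe.comp (continuous_weight ht y₀)).inv₀ fun y => (hpos y).ne').mul hg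
  have hbdd (y : Z) : ‖(weight t y₀ y : ℝ)⁻¹ * g y‖ ≤ |K| * K' := by
    rw [norm_mul, norm_inv, Real.norm_of_nonneg (hpos y).le, inv_mul_le_iff₀ (hpos y)]
    calc |g y| ≤ K * weight t y₁ y := by simpa [coe_weight] using hK y
      _ ≤ |K| * (K' * weight t y₀ y) := by
        gcongr
        · exact le_abs_self K
        · exact_mod_cast hK' y
      _ = _ := by ring
  simp only [integral_eq_integral_weighted ht y₀]
  exact FiniteMeasure.tendsto_iff_forall_integral_tendsto.1 h
      (BoundedContinuousFunction.ofNormedAddCommGroup _ hcont _ hbdd)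

lemma tendsto_ptSpace_of_hatSup [TopologicalSpace.SeparableSpace Z] [Nonempty Z] {t : ℝ}
    (ht : 1 ≤ t) (y₀ : Z) {α : Type*} {L : Filter α} {ps : α → PtSpace t Z} {p : PtSpace t Z}
    (h : ∀ s, Tendsto (fun i => ∫⁻ y, weight t y₀ y * hatSup s y ∂((ps i).1 : Measure Z)) L
      (𝓝 (∫⁻ y, weight t y₀ y * hatSup s y ∂(p.1 : Measure Z)))) :
    Tendsto ps L (𝓝 p) := by
  refine tendsto_ptSpace_of_weighted ht y₀ (tendsto_finiteMeasure_of_hatSup fun s => ?_)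
  simpa only [lintegral_weighted ht y₀ _ (continuous_hatSup s).measurable.coe_nnreal_ennreal]
    using h s

end Weight

section Prokhorov

lemma hatSup_le {Z : Type*} [MetricSpace Z] [TopologicalSpace.SeparableSpace Z] [Nonempty Z]
    (s : Finset (ℚ × ℕ × ℕ)) (y : Z) : hatSup s y ≤ s.sup fun j => Real.toNNReal j.1 :=
  Finset.sup_mono_fun fun _ _ => tsub_le_self

lemma tendsto_lintegral_of_le {Z : Type*} [MetricSpace Z] [MeasurableSpace Z] [BorelSpace Z]
    {α : Type*} {L : Filter α} {ms : α → FiniteMeasure Z} {m : FiniteMeasure Z}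
    (h : Tendsto ms L (𝓝 m)) {f : Z → ℝ≥0} (hf : Continuous f) {c : ℝ≥0} (hc : ∀ y, f y ≤ c) :
    Tendsto (fun i => ∫⁻ y, f y ∂(ms i : Measure Z)) L (𝓝 (∫⁻ y, f y ∂(m : Measure Z))) := by
  refine FiniteMeasure.tendsto_iff_forall_lintegral_tendsto.1 h
    (BoundedContinuousFunction.mkOfBound ⟨f, hf⟩ c fun y z => ?_)
  have hy : (f y : ℝ) ≤ c := NNReal.coe_le_coe.2 (hc y)
  have hz : (f z : ℝ) ≤ c := NNReal.coe_le_coe.2 (hc z)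
  rw [ContinuousMap.coe_mk, NNReal.dist_eq, abs_le]
  constructor <;> linarith [(f y).coe_nonneg, (f z).coe_nonneg]

/-- Sequential relative compactness in `𝒫_t(Y)`, in terms of a coercive function `Ψ`. -/
lemma exists_tendsto_ptSpace {t : ℝ} (ht : 1 ≤ t) (y₀ : Y) {K : ℕ → Set Y}
    (hK : ∀ n, IsCompact (K n)) {Ψ : Y → ℝ≥0∞} (hΨ : ∀ y, weight t y₀ y ≤ Ψ y)
    (hΨK : ∀ (n : ℕ), ∀ y ∉ K n, (n + 1) * weight t y₀ y ≤ Ψ y) {ps : ℕ → PtSpace t Y} {M : ℝ≥0}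
    (hM : ∀ᶠ n in atTop, ∫⁻ y, Ψ y ∂((ps n).1 : Measure Y) ≤ M)
    (hlim : ∀ s, ∃ l, Tendsto (fun n => ∫⁻ y, weight t y₀ y * hatSup s y ∂((ps n).1 : Measure Y))
      atTop (𝓝 l)) :
    ∃ p, Tendsto ps atTop (𝓝 p) := by
  have hu : Tendsto (fun n : ℕ => M / ((n : ℝ≥0) + 1)) atTop (𝓝 0) := by
    have := tendsto_one_div_add_atTop_nhds_zero_nat (𝕜 := ℝ≥0)
    simpa [div_eq_mul_inv] using this.const_mul M
  have hw := (continuous_weight ht y₀).measurable.coe_nnreal_ennreal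
  have hcpt := isCompact_setOfPred_finiteMeasure_mass_le_compl_isCompact_le M hu hK
    (Or.inl inferInstance)
  obtain ⟨m, -, hm⟩ := hcpt.exists_mapClusterPt_of_frequently (l := atTop)
    (f := fun n => weighted ht y₀ (ps n)) (Eventually.frequently (by
      filter_upwards [hM] with n hn
      refine ⟨?_, fun k => ?_⟩
      · rw [← ENNReal.coe_le_coe, FiniteMeasure.ennreal_mass]
        refine le_trans ?_ hn
        simpa using (lintegral_weighted ht y₀ (ps n) (f := fun _ => 1) measurable_const).le.trans
          (lintegral_mono fun y => by simpa using hΨ y)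
      · have hKm : MeasurableSet (K k)ᶜ := (hK k).measurableSet.compl
        rw [← ENNReal.coe_le_coe, FiniteMeasure.ennreal_coeFn_eq_coeFn_toMeasure,
          ENNReal.coe_div (by positivity), ENNReal.le_div_iff_mul_le (by simp) (by simp), mul_comm]
        refine le_trans ?_ hn
        change _ * (Measure.withDensity _ _) _ ≤ _
        rw [withDensity_apply _ hKm, ← lintegral_const_mul _ hw]
        refine (setLIntegral_mono' hKm fun y hy => ?_).trans (setLIntegral_le_lintegral _ _)
        simpa using hΨK k y hy))
  obtain ⟨U, hU, hUm⟩ := mapClusterPt_iff_ultrafilter.1 hm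
  have hconv : Tendsto (fun n => weighted ht y₀ (ps n)) atTop (𝓝 m) := by
    refine tendsto_finiteMeasure_of_hatSup fun s => ?_
    obtain ⟨l, hl⟩ := hlim s
    simp only [← lintegral_weighted ht y₀ _
      (continuous_hatSup s).measurable.coe_nnreal_ennreal] at hl
    rwa [← tendsto_nhds_unique (hl.mono_left hU)
      (tendsto_lintegral_of_le hUm (continuous_hatSup s) (hatSup_le s))]
  have hpos (y : Y) : 0 < weight t y₀ y := zero_lt_one.trans_le (one_le_weight t y₀ y)
  have hinv : Continuous fun y => (weight t y₀ y)⁻¹ :=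
    (continuous_weight ht y₀).inv₀ fun y => (hpos y).ne'
  have hcancel (y : Y) : (weight t y₀ y : ℝ≥0∞) * ((weight t y₀ y)⁻¹ : ℝ≥0) = 1 := by
    rw [← ENNReal.coe_mul, mul_inv_cancel₀ (hpos y).ne', ENNReal.coe_one]
  have hone : ∫⁻ y, ((weight t y₀ y)⁻¹ : ℝ≥0) ∂(m : Measure Y) = 1 := by
    refine tendsto_nhds_unique (tendsto_lintegral_of_le hconv hinv (c := 1)
      fun y => inv_le_one_of_one_le₀ (one_le_weight t y₀ y)) ?_
    simp [lintegral_weighted ht y₀ _ hinv.measurable.coe_nnreal_ennreal, hcancel]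
  let p : ProbabilityMeasure Y :=
    ⟨(m : Measure Y).withDensity fun y => ((weight t y₀ y)⁻¹ : ℝ≥0),
      ⟨by rw [withDensity_apply _ .univ, Measure.restrict_univ, hone]⟩⟩
  have hpm : (p : Measure Y).withDensity (fun y => weight t y₀ y) = m := by
    change ((m : Measure Y).withDensity fun y => ((weight t y₀ y)⁻¹ : ℝ≥0)).withDensity _ = _
    rw [← withDensity_mul _ hinv.measurable.coe_nnreal_ennreal hw]
    convert! withDensity_one using 2
    ext y
    simp [mul_comm, hcancel]
  have hp : MemPt t p := by
    rw [memPt_iff ht y₀, ← setLIntegral_univ, ← withDensity_apply _ .univ, hpm]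
    exact measure_ne_top _ _
  refine ⟨⟨p, hp⟩, tendsto_ptSpace_of_weighted ht y₀ ?_⟩
  convert! hconv
  exact Subtype.ext hpm

end Prokhorov

section ExpNeg

/-- The function `s ↦ exp (-s)` on `[0, ∞]`. -/
def expNeg (s : ℝ≥0∞) : ℝ := (EReal.exp (-(s : EReal))).toReal

lemma exp_neg_coe_ennreal_le_one (s : ℝ≥0∞) : EReal.exp (-(s : EReal)) ≤ 1 := by
  rw [← EReal.exp_zero, EReal.exp_le_exp_iff, EReal.neg_le, neg_zero]
  exact EReal.coe_ennreal_nonneg s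

lemma ofReal_expNeg (s : ℝ≥0∞) : ENNReal.ofReal (expNeg s) = EReal.exp (-(s : EReal)) :=
  ENNReal.ofReal_toReal ((exp_neg_coe_ennreal_le_one s).trans_lt ENNReal.one_lt_top).ne

lemma expNeg_nonneg (s : ℝ≥0∞) : 0 ≤ expNeg s := ENNReal.toReal_nonneg

lemma expNeg_le_one (s : ℝ≥0∞) : expNeg s ≤ 1 :=
  ENNReal.toReal_mono ENNReal.one_ne_top (exp_neg_coe_ennreal_le_one s)

lemma expNeg_add (a b : ℝ≥0∞) : expNeg (a + b) = expNeg a * expNeg b := by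
  rw [expNeg, expNeg, expNeg, ← ENNReal.toReal_mul, ← EReal.exp_add, EReal.coe_ennreal_add,
    EReal.neg_add (Or.inl (EReal.coe_ennreal_ne_bot a)) (Or.inr (EReal.coe_ennreal_ne_bot b)),
    sub_eq_add_neg]

lemma measurable_expNeg : Measurable expNeg := by
  unfold expNeg
  fun_prop

lemma exists_tendsto_of_expNeg {s : ℕ → ℝ≥0∞} {l : ℝ}
    (h : Tendsto (fun n => expNeg (s n)) atTop (𝓝 l)) : ∃ l', Tendsto s atTop (𝓝 l') := by
  refine ⟨(-ENNReal.log (ENNReal.ofReal l)).toENNReal, ?_⟩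
  have h1 := (ENNReal.continuous_ofReal.tendsto l).comp h
  have h2 := (ENNReal.continuous_log.tendsto _).comp h1
  have h3 := (continuous_neg.tendsto _).comp h2
  simpa [Function.comp_def, ofReal_expNeg] using (EReal.continuous_toENNReal.tendsto _).comp h3

end ExpNeg

lemma exists_seq_mem_of_midpoint {S : Type*} {A : ℕ → Set S} (hA : Antitone A)
    (hne : ∀ n, (A n).Nonempty) {Q : S → ℝ≥0∞} {D : S → S → ℝ≥0∞} {B : ℝ≥0∞} (hB : B ≠ ∞)
    (hQB : ∀ a, Q a ≤ B)
    (hmid : ∀ n, ∀ a ∈ A n, ∀ b ∈ A n, ∃ c ∈ A n, 2 * Q c + D a b ≤ Q a + Q b)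
    {ε : ℕ → ℝ≥0∞} (hε : ∀ n, ε n ≠ 0) (hε' : Antitone ε) :
    ∃ s : ℕ → S, ∀ n, s n ∈ A n ∧ D (s n) (s (n + 1)) ≤ ε n := by
  let I : ℕ → ℝ≥0∞ := fun n => ⨅ a ∈ A n, Q a
  have hIB (n : ℕ) : I n ≤ B := (hne n).elim fun a ha => (iInf₂_le a ha).trans (hQB a)
  have hImono : Monotone I := fun n m h => biInf_mono (hA h)
  have hsup : ⨆ n, I n ≠ ∞ := ne_top_of_le_ne_top hB (iSup_le hIB)
  let δ : ℕ → ℝ≥0∞ := fun n => ε n / 4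
  have hδ (n : ℕ) : δ n ≠ 0 := ENNReal.div_ne_zero.2 ⟨hε n, by simp⟩
  have hev (n : ℕ) : ∀ᶠ k in atTop, ⨆ n, I n ≤ I k + δ n := by
    by_cases h0 : ⨆ n, I n = 0
    · simp [h0]
    · have := (tendsto_atTop_iSup hImono).eventually
        (lt_mem_nhds (ENNReal.sub_lt_self hsup h0 (hδ n)))
      filter_upwards [this] with k hk
      exact tsub_le_iff_right.1 hk.le
  obtain ⟨φ, hφ, hφI⟩ := extraction_forall_of_eventually hev
  have hsel (n : ℕ) : ∃ a ∈ A (φ n), Q a ≤ I (φ n) + δ n := by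
    have : I (φ n) < I (φ n) + δ n :=
      ENNReal.lt_add_right (ne_top_of_le_ne_top hB (hIB _)) (hδ n)
    simp only [I, iInf_lt_iff] at this
    obtain ⟨a, ha, hlt⟩ := this
    exact ⟨a, ha, hlt.le⟩
  choose s hs hsQ using hsel
  refine ⟨s, fun n => ⟨hA (hφ.id_le n) (hs n), ?_⟩⟩
  obtain ⟨c, hc, hcQ⟩ := hmid (φ n) _ (hs n) _ (hA (hφ.monotone n.le_succ) (hs (n + 1)))
  have hδ' : δ (n + 1) ≤ δ n := ENNReal.div_le_div_right (hε' n.le_succ) 4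
  have h1 (m : ℕ) : I m ≤ ⨆ n, I n := le_iSup I m
  have h2 : I (φ n) ≤ Q c := iInf₂_le c hc
  have hc' : 2 * Q c ≠ ∞ := ENNReal.mul_ne_top (by simp) (ne_top_of_le_ne_top hB (hQB c))
  refine (ENNReal.add_le_add_iff_left hc').1 (hcQ.trans ?_)
  calc Q (s n) + Q (s (n + 1)) ≤ ((Q c + δ n) + δ n) + ((Q c + δ n) + δ n) := by
        gcongr
        · exact (hsQ n).trans (add_le_add_left ((h1 _).trans ((hφI n).trans (by gcongr))) _)
        · exact (hsQ (n + 1)).trans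
            (add_le_add ((h1 _).trans ((hφI n).trans (by gcongr))) hδ')
    _ = 2 * Q c + 4 * δ n := by ring
    _ = 2 * Q c + ε n := by rw [ENNReal.mul_div_cancel (by simp) (by simp)]

lemma exists_tendsto_of_tsum_ne_top {u : ℕ → ℝ}
    (h : ∑' n, 2 ^ n * ENNReal.ofReal ((u n - u (n + 1)) ^ 2) ≠ ∞) :
    ∃ l, Tendsto u atTop (𝓝 l) := by
  have hsum : Summable fun n => 2 ^ n * (u n - u (n + 1)) ^ 2 := by
    simpa [ENNReal.toReal_ofReal (sq_nonneg _)] using ENNReal.summable_toReal h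
  refine cauchySeq_tendsto_of_complete (cauchySeq_of_summable_dist
    (Summable.of_nonneg_of_le (fun _ => dist_nonneg) (fun n => ?_)
      (summable_geometric_two.add hsum)))
  have h2 : (0 : ℝ) < 2 ^ n := by positivity
  have h3 : (1 / 2 : ℝ) ^ n * 2 ^ n = 1 := by rw [← mul_pow]; norm_num
  have h4 : (0 : ℝ) < (1 / 2) ^ n := by positivity
  rw [Real.dist_eq, abs_le]
  constructor <;>
    nlinarith [mul_nonneg h4.le (sq_nonneg (2 ^ n * (u n - u (n + 1)) - 1)),
      mul_nonneg h4.le (sq_nonneg (2 ^ n * (u n - u (n + 1)) + 1)),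
      mul_nonneg h2.le (sq_nonneg (u n - u (n + 1)))]

section Measurability

/-- The integrals of the weighted hat functions. -/
def hatIntegral (t : ℝ) (y₀ : Y) (p : Measure Y) (s : Finset (ℚ × ℕ × ℕ)) : ℝ≥0∞ :=
  ∫⁻ y, weight t y₀ y * hatSup s y ∂p

lemma measurable_comp_of_hatIntegral {t : ℝ} (ht : 1 ≤ t) (y₀ : Y) {F : X × PtSpace t Y → ℝ≥0∞}
    (hF : LowerSemicontinuous F) {f : X → PtSpace t Y}
    (hf : ∀ s, Measurable fun x => hatIntegral t y₀ ((f x).1 : Measure Y) s) :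
    Measurable fun x => F (x, f x) := by
  let Θ : PtSpace t Y → Finset (ℚ × ℕ × ℕ) → ℝ≥0∞ := fun p => hatIntegral t y₀ (p.1 : Measure Y)
  have hΘ (p : PtSpace t Y) : (𝓝 (Θ p)).comap Θ ≤ 𝓝 p := by
    refine tendsto_ptSpace_of_hatSup (L := (𝓝 (Θ p)).comap Θ) ht y₀ (ps := id) fun s => ?_
    exact ((continuous_apply s).tendsto (Θ p)).comp tendsto_comap
  refine measurable_of_Ioi fun c => ?_
  have hU := hF.isOpen_preimage c
  obtain ⟨V, hV, hVU⟩ : ∃ V : Set (X × (Finset (ℚ × ℕ × ℕ) → ℝ≥0∞)), IsOpen V ∧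
      Prod.map id Θ ⁻¹' V = F ⁻¹' Set.Ioi c := by
    refine isOpen_induced_iff.1 ((@isOpen_iff_mem_nhds _ (TopologicalSpace.induced _ _) _).2 ?_)
    rintro ⟨x, p⟩ hxp
    rw [nhds_induced, Prod.map_apply, nhds_prod_eq, Filter.comap_prodMap_prod, comap_id]
    exact Filter.prod_mono le_rfl (hΘ p) (nhds_prod_eq (x := x) (y := p) ▸ hU.mem_nhds hxp)
  rw [show (fun x => F (x, f x)) ⁻¹' Set.Ioi c = (fun x => (x, Θ (f x))) ⁻¹' V from
    Set.ext fun x => (Set.ext_iff.1 hVU (x, f x)).symm]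
  exact (measurable_id.prodMk (measurable_pi_iff.2 hf)) hV.measurableSet

open Classical in
/-- The measure `p` as an element of `𝒫_t(Y)`, or the default value `p₀` if its moment is
infinite. -/
def toPt {t : ℝ} (p₀ : PtSpace t Y) (p : ProbabilityMeasure Y) : PtSpace t Y :=
  if h : MemPt t p then ⟨p, h⟩ else p₀

lemma toPt_of_memPt {t : ℝ} (p₀ : PtSpace t Y) {p : ProbabilityMeasure Y} (h : MemPt t p) :
    toPt p₀ p = ⟨p, h⟩ := dif_pos h

lemma toPt_of_not_memPt {t : ℝ} (p₀ : PtSpace t Y) {p : ProbabilityMeasure Y} (h : ¬MemPt t p) :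
    toPt p₀ p = p₀ := dif_neg h

lemma measurable_hatIntegral {t : ℝ} (ht : 1 ≤ t) (y₀ : Y) (s : Finset (ℚ × ℕ × ℕ)) :
    Measurable fun y => (weight t y₀ y * hatSup s y : ℝ≥0∞) :=
  (continuous_weight ht y₀).measurable.coe_nnreal_ennreal.mul
    (continuous_hatSup s).measurable.coe_nnreal_ennreal

/-- A Markov kernel as a map into probability measures. -/
def Kernel.toProb (κ : Kernel X Y) [IsMarkovKernel κ] (x : X) : ProbabilityMeasure Y :=
  ⟨κ x, inferInstance⟩

lemma measurable_cost {t : ℝ} (ht : 1 ≤ t) {F : X × PtSpace t Y → ℝ≥0∞}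
    (hF : LowerSemicontinuous F) (p₀ : PtSpace t Y) (κ : Kernel X Y) [IsMarkovKernel κ] :
    Measurable fun x => F (x, toPt p₀ (Kernel.toProb κ x)) := by
  classical
  let y₀ : Y := Classical.arbitrary Y
  refine measurable_comp_of_hatIntegral ht y₀ hF fun s => ?_
  have hset : MeasurableSet {x | MemPt t (Kernel.toProb κ x)} := by
    simp only [memPt_iff ht y₀]
    exact ((Measurable.lintegral_kernel (κ := κ)
      (continuous_weight ht y₀).measurable.coe_nnreal_ennreal)
      (measurableSet_singleton ∞)).compl
  have : (fun x => hatIntegral t y₀ ((toPt p₀ (Kernel.toProb κ x)).1 : Measure Y) s) =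
      {x | MemPt t (Kernel.toProb κ x)}.piecewise
        (fun x => hatIntegral t y₀ (κ x) s) (fun _ => hatIntegral t y₀ (p₀.1 : Measure Y) s) := by
    ext x
    by_cases h : MemPt t (Kernel.toProb κ x)
    · rw [toPt_of_memPt p₀ h]
      exact (if_pos h).symm
    · rw [toPt_of_not_memPt p₀ h]
      exact (if_neg h).symm
  rw [this]
  exact Measurable.piecewise hset (measurable_hatIntegral ht y₀ s).lintegral_kernel
    measurable_const

end Measurability

section Midpoint

variable {α β : Type*} [MeasurableSpace α] [MeasurableSpace β]

/-- The midpoint of two kernels. -/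
def midKernel (κ κ' : Kernel α β) : Kernel α β where
  toFun x := (2⁻¹ : ℝ≥0∞) • κ x + (2⁻¹ : ℝ≥0∞) • κ' x
  measurable' := by
    refine Measure.measurable_of_measurable_coe _ fun s hs => ?_
    simp only [Measure.coe_add, Measure.coe_smul, Pi.add_apply, Pi.smul_apply, smul_eq_mul]
    exact ((κ.measurable_coe hs).const_mul _).add ((κ'.measurable_coe hs).const_mul _)

lemma midKernel_apply (κ κ' : Kernel α β) (x : α) :
    midKernel κ κ' x = (2⁻¹ : ℝ≥0∞) • κ x + (2⁻¹ : ℝ≥0∞) • κ' x := rfl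

lemma isMarkovKernel_midKernel (κ κ' : Kernel α β) [IsMarkovKernel κ] [IsMarkovKernel κ'] :
    IsMarkovKernel (midKernel κ κ') :=
  ⟨fun x => ⟨by simp [midKernel_apply, ENNReal.inv_two_add_inv_two]⟩⟩

lemma lintegral_midKernel (κ κ' : Kernel α β) (x : α) (f : β → ℝ≥0∞) :
    ∫⁻ y, f y ∂midKernel κ κ' x = 2⁻¹ * ∫⁻ y, f y ∂κ x + 2⁻¹ * ∫⁻ y, f y ∂κ' x := by
  simp [midKernel_apply, lintegral_add_measure, lintegral_smul_measure]

lemma bind_midKernel (κ κ' : Kernel α β) {μ : Measure α} {ν : Measure β}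
    (h : μ.bind κ = ν) (h' : μ.bind κ' = ν) : μ.bind (midKernel κ κ') = ν := by
  ext s hs
  have e (κ : Kernel α β) : μ.bind κ s = ∫⁻ x, κ x s ∂μ :=
    Measure.bind_apply hs κ.measurable.aemeasurable
  rw [e]
  simp only [midKernel_apply, Measure.coe_add, Measure.coe_smul, Pi.add_apply, Pi.smul_apply,
    smul_eq_mul]
  rw [lintegral_add_left ((κ.measurable_coe hs).const_mul _),
    lintegral_const_mul _ (κ.measurable_coe hs), lintegral_const_mul _ (κ'.measurable_coe hs),
    ← e, ← e, h, h', ← add_mul, ENNReal.inv_two_add_inv_two, one_mul]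

variable {ι : Type*} [Countable ι]

/-- A strictly convex energy of a kernel, built from the integrals of the functions `h k`. -/
def kernelEnergy (μ : Measure α) (c : ι → ℝ≥0∞) (h : ι → β → ℝ≥0∞) (κ : Kernel α β) : ℝ≥0∞ :=
  ∫⁻ x, ∑' k, c k * ENNReal.ofReal (expNeg (∫⁻ y, h k y ∂κ x) ^ 2) ∂μ

/-- The convexity gap of `kernelEnergy`. -/
def kernelGap (μ : Measure α) (c : ι → ℝ≥0∞) (h : ι → β → ℝ≥0∞) (κ κ' : Kernel α β) : ℝ≥0∞ :=
  ∫⁻ x, ∑' k, c k *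
    ENNReal.ofReal ((expNeg (∫⁻ y, h k y ∂κ x) - expNeg (∫⁻ y, h k y ∂κ' x)) ^ 2) ∂μ

variable {μ : Measure α} {c : ι → ℝ≥0∞} {h : ι → β → ℝ≥0∞}

lemma measurable_expNeg_lintegral (hh : ∀ k, Measurable (h k)) (κ : Kernel α β) (k : ι) :
    Measurable fun x => expNeg (∫⁻ y, h k y ∂κ x) :=
  measurable_expNeg.comp (hh k).lintegral_kernel

lemma kernelEnergy_le [IsProbabilityMeasure μ] (κ : Kernel α β) :
    kernelEnergy μ c h κ ≤ ∑' k, c k := by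
  refine (lintegral_mono (g := fun _ => ∑' k, c k) fun x => ENNReal.tsum_le_tsum fun k => ?_).trans
    (by simp)
  refine mul_le_of_le_one_right' (ENNReal.ofReal_le_one.2 ?_)
  exact pow_le_one₀ (expNeg_nonneg _) (expNeg_le_one _)

lemma kernelEnergy_midKernel (hh : ∀ k, Measurable (h k)) (κ κ' : Kernel α β) :
    2 * kernelEnergy μ c h (midKernel κ κ') + kernelGap μ c h κ κ' =
      kernelEnergy μ c h κ + kernelEnergy μ c h κ' := by
  have hm := measurable_expNeg_lintegral (α := α) hh
  have hE (κ : Kernel α β) : Measurable fun x =>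
      ∑' k, c k * ENNReal.ofReal (expNeg (∫⁻ y, h k y ∂κ x) ^ 2) :=
    Measurable.tsum fun k => (((hm κ k).pow_const 2).ennreal_ofReal).const_mul _
  simp only [kernelEnergy, kernelGap]
  rw [← lintegral_const_mul _ (hE _), ← lintegral_add_left ((hE _).const_mul _),
    ← lintegral_add_left (hE _)]
  refine lintegral_congr fun x => ?_
  rw [← ENNReal.tsum_mul_left, ← ENNReal.tsum_add, ← ENNReal.tsum_add]
  refine tsum_congr fun k => ?_
  have hmid : expNeg (∫⁻ y, h k y ∂midKernel κ κ' x) ^ 2 =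
      expNeg (∫⁻ y, h k y ∂κ x) * expNeg (∫⁻ y, h k y ∂κ' x) := by
    rw [pow_two, ← expNeg_add, ← expNeg_add, lintegral_midKernel, add_add_add_comm, ← add_mul,
      ← add_mul, ENNReal.inv_two_add_inv_two, one_mul, one_mul]
  rw [hmid, mul_left_comm, ← mul_add, ← mul_add]
  congr 1
  have h1 := expNeg_nonneg (∫⁻ y, h k y ∂κ x)
  have h2 := expNeg_nonneg (∫⁻ y, h k y ∂κ' x)
  rw [← ENNReal.ofReal_ofNat, ← ENNReal.ofReal_mul (by norm_num),
    ← ENNReal.ofReal_add (by positivity) (by positivity),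
    ← ENNReal.ofReal_add (by positivity) (by positivity)]
  congr 1
  ring

lemma ae_tendsto_of_kernelGap_le (hh : ∀ k, Measurable (h k)) (hc : ∀ k, c k ≠ 0)
    {κ : ℕ → Kernel α β} (hκ : ∀ n, kernelGap μ c h (κ n) (κ (n + 1)) ≤ 4⁻¹ ^ n) :
    ∀ᵐ x ∂μ, ∀ k, ∃ l, Tendsto (fun n => ∫⁻ y, h k y ∂κ n x) atTop (𝓝 l) := by
  have hm := measurable_expNeg_lintegral (α := α) hh
  let g (n : ℕ) (x : α) (k : ι) : ℝ≥0∞ := ENNReal.ofReal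
    ((expNeg (∫⁻ y, h k y ∂κ n x) - expNeg (∫⁻ y, h k y ∂κ (n + 1) x)) ^ 2)
  have hg (n : ℕ) : Measurable fun x => ∑' k, c k * g n x k :=
    Measurable.tsum fun k => ((((hm _ k).sub (hm _ k)).pow_const 2).ennreal_ofReal).const_mul _
  have hg' : Measurable fun x => ∑' n, 2 ^ n * ∑' k, c k * g n x k :=
    Measurable.tsum fun n => (hg n).const_mul _
  have hfin : ∫⁻ x, ∑' n, 2 ^ n * ∑' k, c k * g n x k ∂μ ≠ ∞ := by
    rw [lintegral_tsum fun n => ((hg n).const_mul _).aemeasurable]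
    simp only [lintegral_const_mul _ (hg _)]
    refine ne_top_of_le_ne_top (b := ∑' n : ℕ, (2⁻¹ : ℝ≥0∞) ^ n) (by simp)
      (ENNReal.tsum_le_tsum fun n => (mul_le_mul_right (hκ n) _).trans ?_)
    rw [← mul_pow]
    refine pow_le_pow_left₀ zero_le (le_of_eq ?_) n
    rw [show (4 : ℝ≥0∞) = 2 * 2 by norm_num, ENNReal.mul_inv (by simp) (by simp), ← mul_assoc,
      ENNReal.mul_inv_cancel (by simp) (by simp), one_mul]
  filter_upwards [ae_lt_top hg' hfin] with x hx k
  obtain ⟨l, hl⟩ := exists_tendsto_of_tsum_ne_top (u := fun n => expNeg (∫⁻ y, h k y ∂κ n x)) (by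
    intro htop
    refine hx.ne (top_le_iff.1 ?_)
    rw [← ENNReal.mul_top (hc k), ← htop, ← ENNReal.tsum_mul_left]
    refine ENNReal.tsum_le_tsum fun n => ?_
    rw [mul_left_comm]
    exact mul_le_mul_right (ENNReal.le_tsum (f := fun k => c k * g n x k) k) _)
  exact exists_tendsto_of_expNeg hl

lemma exists_seq_kernel_tendsto [IsProbabilityMeasure μ] (hh : ∀ k, Measurable (h k))
    {A : ℕ → Set (Kernel α β)} (hA : Antitone A) (hne : ∀ n, (A n).Nonempty)
    (hmid : ∀ n, ∀ κ ∈ A n, ∀ κ' ∈ A n, midKernel κ κ' ∈ A n) :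
    ∃ κ : ℕ → Kernel α β, (∀ n, κ n ∈ A n) ∧
      ∀ᵐ x ∂μ, ∀ k, ∃ l, Tendsto (fun n => ∫⁻ y, h k y ∂κ n x) atTop (𝓝 l) := by
  obtain ⟨c, hc, hsum⟩ := ENNReal.exists_pos_sum_of_countable' one_ne_zero ι
  obtain ⟨κ, hκ⟩ := exists_seq_mem_of_midpoint hA hne (Q := kernelEnergy μ c h)
    (D := kernelGap μ c h) hsum.ne_top kernelEnergy_le
    (fun n κ hκ κ' hκ' => ⟨_, hmid n κ hκ κ' hκ', (kernelEnergy_midKernel hh κ κ').le⟩)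
    (ε := fun n => 4⁻¹ ^ n) (fun n => by simp)
    (pow_right_anti₀ zero_le (ENNReal.inv_le_one.2 (by norm_num)))
  exact ⟨κ, fun n => (hκ n).1, ae_tendsto_of_kernelGap_le hh (fun k => (hc k).ne')
    fun n => (hκ n).2⟩

end Midpoint

section Limit

lemma exists_coercive {t : ℝ} (ht : 1 ≤ t) (y₀ : Y) (ν : PtSpace t Y) :
    ∃ (K : ℕ → Set Y) (Ψ : Y → ℝ≥0∞), (∀ n, IsCompact (K n)) ∧ Measurable Ψ ∧
      (∀ y, weight t y₀ y ≤ Ψ y) ∧ (∀ (n : ℕ), ∀ y ∉ K n, (n + 1) * weight t y₀ y ≤ Ψ y) ∧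
      ∫⁻ y, Ψ y ∂(ν.1 : Measure Y) ≠ ∞ := by
  obtain ⟨ε, hε, hsum⟩ := ENNReal.exists_pos_sum_of_countable' one_ne_zero ℕ
  have htight := isTightMeasureSet_iff_exists_isCompact_measure_compl_le.1
    (isTightMeasureSet_singleton (μ := (weighted ht y₀ ν : Measure Y)))
  choose K hK hKε using fun n : ℕ => htight (ε n / (n + 1))
    (ENNReal.div_pos (hε n).ne' (by finiteness))
  have hind (n : ℕ) : Measurable (((K n)ᶜ).indicator fun _ => (n + 1 : ℝ≥0∞)) :=
    measurable_const.indicator (hK n).measurableSet.compl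
  have hm : Measurable fun y => 1 + ∑' n, ((K n)ᶜ).indicator (fun _ => (n + 1 : ℝ≥0∞)) y :=
    (Measurable.tsum hind).const_add 1
  refine ⟨K, fun y => weight t y₀ y * (1 + ∑' n, ((K n)ᶜ).indicator (fun _ => (n + 1 : ℝ≥0∞)) y),
    hK, (continuous_weight ht y₀).measurable.coe_nnreal_ennreal.mul hm,
    fun y => le_mul_of_one_le_right' le_self_add, fun n y hy => ?_, ?_⟩
  · rw [mul_comm]
    refine mul_le_mul_right (le_add_left ?_) _
    refine le_trans (le_of_eq ?_) (ENNReal.le_tsum n)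
    rw [Set.indicator_of_mem hy]
  · rw [← lintegral_weighted ht y₀ ν hm, lintegral_add_left measurable_const,
      lintegral_tsum fun n => (hind n).aemeasurable]
    refine ENNReal.add_ne_top.2 ⟨by simp, ne_top_of_le_ne_top hsum.ne_top
      (ENNReal.tsum_le_tsum fun n => ?_)⟩
    rw [lintegral_indicator_const (hK n).measurableSet.compl, mul_comm]
    exact (ENNReal.le_div_iff_mul_le (by simp) (by simp)).1 (hKε n _ rfl)

lemma tendsto_probabilityMeasure_of_tendsto_ptSpace {t : ℝ} {α : Type*} {L : Filter α}
    {ps : α → PtSpace t Y} {p : PtSpace t Y} (h : Tendsto ps L (𝓝 p)) :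
    Tendsto (fun i => (ps i).1) L (𝓝 p.1) := by
  refine ProbabilityMeasure.tendsto_iff_forall_integral_tendsto.2 fun f => ?_
  have := h.mono_right (nhds_mono (iInf₂_le (f : Y → ℝ) ⟨f.continuous, ‖f‖, Classical.arbitrary Y,
    fun y => (f.norm_coe_le_norm y).trans (le_mul_of_one_le_right (norm_nonneg f)
      (le_add_of_nonneg_right (Real.rpow_nonneg dist_nonneg t)))⟩))
  rw [nhds_induced, tendsto_comap_iff] at this
  exact this

lemma measurable_of_tendsto_probabilityMeasure {α Z : Type*} [MeasurableSpace α] [MetricSpace Z]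
    [MeasurableSpace Z] [BorelSpace Z] {f : ℕ → α → ProbabilityMeasure Z}
    {g : α → ProbabilityMeasure Z} (hf : ∀ n, Measurable fun x => (f n x : Measure Z))
    (h : ∀ x, Tendsto (fun n => f n x) atTop (𝓝 (g x))) :
    Measurable fun x => (g x : Measure Z) := by
  refine Measurable.measure_of_isPiSystem_of_isProbabilityMeasure
    (BorelSpace.measurable_eq.trans borel_eq_generateFrom_isClosed) isPiSystem_isClosed
    fun F hF => ?_
  refine measurable_of_tendsto_metrizable (f := fun n x =>
    ∫⁻ z, thickenedIndicator (Nat.one_div_pos_of_nat (α := ℝ) (n := n)) F z ∂(g x : Measure Z))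
    (fun n => ?_) (tendsto_pi_nhds.2 fun x => tendsto_lintegral_thickenedIndicator_of_isClosed _ hF
      (fun n => Nat.one_div_pos_of_nat) tendsto_one_div_add_atTop_nhds_zero_nat)
  refine measurable_of_tendsto_metrizable (f := fun m x =>
    ∫⁻ z, thickenedIndicator (Nat.one_div_pos_of_nat (α := ℝ) (n := n)) F z ∂(f m x : Measure Z))
    (fun m => ?_) (tendsto_pi_nhds.2 fun x =>
      ProbabilityMeasure.tendsto_iff_forall_lintegral_tendsto.1 (h x) _)
  exact (Measure.measurable_lintegral
    (thickenedIndicator _ F).continuous.measurable.coe_nnreal_ennreal).comp (hf m)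

/-- An almost everywhere defined limit of Markov kernels is a Markov kernel. -/
lemma exists_kernel_limit {μ : Measure X} {κ : ℕ → Kernel X Y} [∀ n, IsMarkovKernel (κ n)]
    (h : ∀ᵐ x ∂μ, ∃ p, Tendsto (fun n => Kernel.toProb (κ n) x) atTop (𝓝 p)) :
    ∃ (κ' : Kernel X Y) (_ : IsMarkovKernel κ'),
      ∀ᵐ x ∂μ, Tendsto (fun n => Kernel.toProb (κ n) x) atTop (𝓝 (Kernel.toProb κ' x)) := by
  classical
  let N : Set X := toMeasurable μ {x | ¬∃ p, Tendsto (fun n => Kernel.toProb (κ n) x) atTop (𝓝 p)}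
  have hN : MeasurableSet N := measurableSet_toMeasurable _ _
  have hμN : μ N = 0 := (measure_toMeasurable _).trans h
  let p₀ : ProbabilityMeasure Y := ⟨.dirac (Classical.arbitrary Y), inferInstance⟩
  let f (n : ℕ) (x : X) : ProbabilityMeasure Y := if x ∈ N then p₀ else Kernel.toProb (κ n) x
  have hex (x : X) : ∃ p, Tendsto (fun n => f n x) atTop (𝓝 p) := by
    by_cases hx : x ∈ N
    · exact ⟨p₀, by simp [f, hx]⟩
    · simp only [f, hx, if_false]
      by_contra hcon
      exact hx (subset_toMeasurable _ _ hcon)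
  choose g hg using hex
  refine ⟨⟨fun x => g x, measurable_of_tendsto_probabilityMeasure (fun n => ?_) hg⟩,
    ⟨fun x => (g x).2⟩, ?_⟩
  · simp only [f, apply_ite (fun p : ProbabilityMeasure Y => (p : Measure Y))]
    exact Measurable.ite hN measurable_const (κ n).measurable
  · filter_upwards [measure_eq_zero_iff_ae_notMem.1 hμN] with x hx
    have := hg x
    simp only [f, hx, if_false] at this
    exact this

lemma bind_eq_of_tendsto {μ : Measure X} [IsProbabilityMeasure μ] {κ : ℕ → Kernel X Y}
    [∀ n, IsMarkovKernel (κ n)] {κ' : Kernel X Y} [IsMarkovKernel κ'] {ν : Measure Y}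
    (hκ : ∀ n, μ.bind (κ n) = ν)
    (h : ∀ᵐ x ∂μ, Tendsto (fun n => Kernel.toProb (κ n) x) atTop (𝓝 (Kernel.toProb κ' x))) :
    μ.bind κ' = ν := by
  have : IsFiniteMeasure ν := hκ 0 ▸ inferInstance
  refine ext_of_forall_lintegral_eq_of_IsFiniteMeasure fun f => ?_
  have hf : Measurable fun y => (f y : ℝ≥0∞) := f.continuous.measurable.coe_nnreal_ennreal
  have e (κ : Kernel X Y) : ∫⁻ y, f y ∂(μ.bind κ) = ∫⁻ x, ∫⁻ y, f y ∂κ x ∂μ :=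
    Measure.lintegral_bind κ.measurable.aemeasurable hf.aemeasurable
  rw [e]
  refine tendsto_nhds_unique (tendsto_lintegral_of_dominated_convergence
    (F := fun n x => ∫⁻ y, f y ∂κ n x) (fun _ => (nndist f 0 : ℝ≥0∞))
    (fun n => hf.lintegral_kernel) (fun n => ae_of_all _ fun x => ?_) (by simp) ?_) ?_
  · refine (lintegral_mono (g := fun _ => (nndist f 0 : ℝ≥0∞)) fun y => ?_).trans (by simp)
    exact ENNReal.coe_le_coe.2 (BoundedContinuousFunction.NNReal.upper_bound f y)
  · filter_upwards [h] with x hx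
    exact ProbabilityMeasure.tendsto_iff_forall_lintegral_tendsto.1 hx f
  · simp only [← e, hκ]
    exact tendsto_const_nhds

end Limit

section Minimizer

variable {t : ℝ} {μ : Measure X}

lemma lintegral_lintegral_of_bind {κ : Kernel X Y} {ν : Measure Y} (h : μ.bind κ = ν)
    {f : Y → ℝ≥0∞} (hf : Measurable f) : ∫⁻ x, ∫⁻ y, f y ∂κ x ∂μ = ∫⁻ y, f y ∂ν := by
  rw [← h, Measure.lintegral_bind κ.measurable.aemeasurable hf.aemeasurable]

lemma ae_memPt_of_bind (ht : 1 ≤ t) (ν : PtSpace t Y) {κ : Kernel X Y} [IsMarkovKernel κ]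
    (h : μ.bind κ = ν.1) : ∀ᵐ x ∂μ, MemPt t (Kernel.toProb κ x) := by
  let y₀ : Y := Classical.arbitrary Y
  have hw := (continuous_weight ht y₀).measurable.coe_nnreal_ennreal
  have hfin := (memPt_iff ht y₀ ν.1).1 ν.2
  rw [← lintegral_lintegral_of_bind h hw] at hfin
  filter_upwards [ae_lt_top hw.lintegral_kernel hfin] with x hx
  exact (memPt_iff ht y₀ _).2 hx.ne

/-- The weak transport cost of a Markov kernel. -/
def kernelCost (F : X × PtSpace t Y → ℝ≥0∞) (ν : PtSpace t Y) (μ : Measure X) (κ : Kernel X Y)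
    [IsMarkovKernel κ] : ℝ≥0∞ :=
  ∫⁻ x, F (x, toPt ν (Kernel.toProb κ x)) ∂μ

variable {F : X × PtSpace t Y → ℝ≥0∞}

lemma kernelCost_midKernel_le (ht : 1 ≤ t) (hF : LowerSemicontinuous F)
    (hconv : ∀ x (p q r : PtSpace t Y), (r.1 : Measure Y) =
      (2⁻¹ : ℝ≥0∞) • (p.1 : Measure Y) + (2⁻¹ : ℝ≥0∞) • (q.1 : Measure Y) →
      F (x, r) ≤ 2⁻¹ * F (x, p) + 2⁻¹ * F (x, q)) (ν : PtSpace t Y) {κ κ' : Kernel X Y}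
    [IsMarkovKernel κ] [IsMarkovKernel κ'] [IsMarkovKernel (midKernel κ κ')]
    (h : μ.bind κ = ν.1) (h' : μ.bind κ' = ν.1) :
    kernelCost F ν μ (midKernel κ κ') ≤
      2⁻¹ * kernelCost F ν μ κ + 2⁻¹ * kernelCost F ν μ κ' := by
  have hm := measurable_cost ht hF ν κ
  have hm' := measurable_cost ht hF ν κ'
  unfold kernelCost
  rw [← lintegral_const_mul _ hm, ← lintegral_const_mul _ hm',
    ← lintegral_add_left (hm.const_mul _)]
  refine lintegral_mono_ae ?_
  filter_upwards [ae_memPt_of_bind ht ν h, ae_memPt_of_bind ht ν h',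
    ae_memPt_of_bind ht ν (bind_midKernel κ κ' h h')] with x h1 h2 h3
  refine hconv _ _ _ _ ?_
  rw [toPt_of_memPt ν h1, toPt_of_memPt ν h2, toPt_of_memPt ν h3]
  exact midKernel_apply κ κ' x

/-- The almost optimal kernels. -/
def nearOptimal (F : X × PtSpace t Y → ℝ≥0∞) (ν : PtSpace t Y) (μ : Measure X) (v : ℝ≥0∞) :
    Set (Kernel X Y) :=
  {κ | ∃ _ : IsMarkovKernel κ, μ.bind κ = ν.1 ∧ kernelCost F ν μ κ ≤ v}

lemma midKernel_mem_nearOptimal (ht : 1 ≤ t) (hF : LowerSemicontinuous F)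
    (hconv : ∀ x (p q r : PtSpace t Y), (r.1 : Measure Y) =
      (2⁻¹ : ℝ≥0∞) • (p.1 : Measure Y) + (2⁻¹ : ℝ≥0∞) • (q.1 : Measure Y) →
      F (x, r) ≤ 2⁻¹ * F (x, p) + 2⁻¹ * F (x, q)) (ν : PtSpace t Y) {v : ℝ≥0∞} {κ κ' : Kernel X Y}
    (h : κ ∈ nearOptimal F ν μ v) (h' : κ' ∈ nearOptimal F ν μ v) :
    midKernel κ κ' ∈ nearOptimal F ν μ v := by
  obtain ⟨_, h1, h2⟩ := h
  obtain ⟨_, h1', h2'⟩ := h'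
  refine ⟨isMarkovKernel_midKernel κ κ', bind_midKernel κ κ' h1 h1', ?_⟩
  have := isMarkovKernel_midKernel κ κ'
  refine (kernelCost_midKernel_le ht hF hconv ν h1 h1').trans ?_
  calc _ ≤ 2⁻¹ * v + 2⁻¹ * v := by gcongr
    _ = v := by rw [← add_mul, ENNReal.inv_two_add_inv_two, one_mul]

lemma exists_kernel_tendsto [IsProbabilityMeasure μ] (ht : 1 ≤ t) (ν : PtSpace t Y)
    {A : ℕ → Set (Kernel X Y)} (hA : Antitone A) (hne : ∀ n, (A n).Nonempty)
    (hmid : ∀ n, ∀ κ ∈ A n, ∀ κ' ∈ A n, midKernel κ κ' ∈ A n)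
    (hM : ∀ n, ∀ κ ∈ A n, IsMarkovKernel κ) (hν : ∀ n, ∀ κ ∈ A n, μ.bind κ = ν.1) :
    ∃ (κ : ℕ → Kernel X Y) (_ : ∀ n, IsMarkovKernel (κ n)), (∀ n, κ n ∈ A n) ∧
      ∀ᵐ x ∂μ, ∃ p, Tendsto (fun n => toPt ν (Kernel.toProb (κ n) x)) atTop (𝓝 p) := by
  let y₀ : Y := Classical.arbitrary Y
  obtain ⟨K, Ψ, hK, hΨm, hΨ, hΨK, hΨν⟩ := exists_coercive ht y₀ ν
  let h : Option (Finset (ℚ × ℕ × ℕ)) → Y → ℝ≥0∞ := fun k => k.elim Ψ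
    fun s y => weight t y₀ y * hatSup s y
  have hh (k) : Measurable (h k) := by
    cases k with
    | none => exact hΨm
    | some s => exact measurable_hatIntegral ht y₀ s
  obtain ⟨κ, hκ, hlim⟩ := exists_seq_kernel_tendsto (μ := μ) hh hA hne hmid
  have hMκ (n : ℕ) := hM n _ (hκ n)
  refine ⟨κ, hMκ, hκ, ?_⟩
  have hliminf : ∫⁻ x, liminf (fun n => ∫⁻ y, Ψ y ∂κ n x) atTop ∂μ ≠ ∞ := by
    refine ne_top_of_le_ne_top hΨν ((lintegral_liminf_le fun n => hΨm.lintegral_kernel).trans ?_)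
    simp only [lintegral_lintegral_of_bind (hν _ _ (hκ _)) hΨm, liminf_const, le_refl]
  filter_upwards [hlim, ae_lt_top (Measurable.liminf fun n => hΨm.lintegral_kernel) hliminf,
    ae_all_iff.2 fun n => ae_memPt_of_bind ht ν (hν n _ (hκ n))] with x hx hxfin hmem
  obtain ⟨l, hl⟩ := hx none
  have hl' : l < ∞ := by
    rw [← hl.liminf_eq]
    exact hxfin
  obtain ⟨M, hlM, hM⟩ := ENNReal.lt_iff_exists_nnreal_btwn.1 hl'
  have hval (n : ℕ) : ((toPt ν (Kernel.toProb (κ n) x)).1 : Measure Y) = κ n x := by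
    rw [toPt_of_memPt ν (hmem n)]
    rfl
  refine exists_tendsto_ptSpace ht y₀ hK hΨ hΨK (M := M) ?_ fun s => ?_
  · simp only [hval]
    filter_upwards [hl.eventually (gt_mem_nhds hlM)] with n hn using hn.le
  · simp only [hval]
    exact hx (some s)

lemma exists_kernel_minimizer [IsProbabilityMeasure μ] (ht : 1 ≤ t) (hF : LowerSemicontinuous F)
    (hconv : ∀ x (p q r : PtSpace t Y), (r.1 : Measure Y) =
      (2⁻¹ : ℝ≥0∞) • (p.1 : Measure Y) + (2⁻¹ : ℝ≥0∞) • (q.1 : Measure Y) →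
      F (x, r) ≤ 2⁻¹ * F (x, p) + 2⁻¹ * F (x, q)) (ν : PtSpace t Y) :
    ∃ (κ : Kernel X Y) (_ : IsMarkovKernel κ), μ.bind κ = ν.1 ∧
      ∀ (κ' : Kernel X Y) [IsMarkovKernel κ'], μ.bind κ' = ν.1 →
        kernelCost F ν μ κ ≤ kernelCost F ν μ κ' := by
  let V : ℝ≥0∞ := ⨅ (κ : Kernel X Y) (_ : IsMarkovKernel κ) (_ : μ.bind κ = ν.1), kernelCost F ν μ κ
  let v : ℕ → ℝ≥0∞ := fun n => V + (n : ℝ≥0∞)⁻¹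
  have hv : Tendsto v atTop (𝓝 V) := by
    simpa using tendsto_const_nhds.add ENNReal.tendsto_inv_nat_nhds_zero
  have hvanti : Antitone v := fun n m hnm => by
    simp only [v]
    gcongr
  have hconst : IsMarkovKernel (Kernel.const X (ν.1 : Measure Y)) := inferInstance
  have hne (n : ℕ) : (nearOptimal F ν μ (v n)).Nonempty := by
    by_cases hV : V = ∞
    · exact ⟨Kernel.const X ν.1, hconst, by simp, by simp [v, hV]⟩
    · have : V < v n := ENNReal.lt_add_right hV (by simp)
      simp only [V, iInf_lt_iff] at this
      obtain ⟨κ, hκ, hκ', hlt⟩ := this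
      exact ⟨κ, hκ, hκ', hlt.le⟩
  obtain ⟨κ, hM, hκ, hlim⟩ := exists_kernel_tendsto (μ := μ) ht ν
    (A := fun n => nearOptimal F ν μ (v n))
    (fun n m hnm κ ⟨h1, h2, h3⟩ => ⟨h1, h2, h3.trans (hvanti hnm)⟩) hne
    (fun n κ h κ' h' => midKernel_mem_nearOptimal ht hF hconv ν h h')
    (fun n κ h => h.1) (fun n κ h => h.2.1)
  have hbind (n : ℕ) : μ.bind (κ n) = ν.1 := (hκ n).2.1
  have hmem : ∀ᵐ x ∂μ, ∀ n, MemPt t (Kernel.toProb (κ n) x) :=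
    ae_all_iff.2 fun n => ae_memPt_of_bind ht ν (hbind n)
  obtain ⟨κ', hκ', hκlim⟩ := exists_kernel_limit (μ := μ) (κ := κ) (by
    filter_upwards [hlim, hmem] with x ⟨p, hp⟩ hx
    refine ⟨p.1, ?_⟩
    simpa only [toPt_of_memPt ν (hx _)] using tendsto_probabilityMeasure_of_tendsto_ptSpace hp)
  refine ⟨κ', hκ', bind_eq_of_tendsto hbind hκlim, fun κ₁ hκ₁ h₁ => ?_⟩
  calc kernelCost F ν μ κ'
      ≤ ∫⁻ x, liminf (fun n => F (x, toPt ν (Kernel.toProb (κ n) x))) atTop ∂μ := by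
        refine lintegral_mono_ae ?_
        filter_upwards [hlim, hmem, hκlim] with x ⟨p, hp⟩ hx hx'
        have hpx : p.1 = Kernel.toProb κ' x := by
          refine tendsto_nhds_unique ?_ hx'
          simpa only [toPt_of_memPt ν (hx _)] using
            tendsto_probabilityMeasure_of_tendsto_ptSpace hp
        have hp' : toPt ν (Kernel.toProb κ' x) = p := by
          rw [toPt_of_memPt ν (hpx ▸ p.2)]
          exact Subtype.ext hpx.symm
        rw [hp']
        have hpair : Tendsto (fun n => (x, toPt ν (Kernel.toProb (κ n) x))) atTop (𝓝 (x, p)) :=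
          tendsto_const_nhds.prodMk_nhds hp
        exact (lowerSemicontinuousAt_iff_le_liminf.1 (hF (x, p))).trans
          (liminf_le_liminf_of_le hpair)
    _ ≤ liminf (fun n => kernelCost F ν μ (κ n)) atTop :=
        lintegral_liminf_le fun n => measurable_cost ht hF ν (κ n)
    _ ≤ liminf v atTop := liminf_le_liminf (Eventually.of_forall fun n => (hκ n).2.2)
    _ = V := hv.liminf_eq
    _ ≤ kernelCost F ν μ κ₁ := iInf_le_of_le κ₁ (iInf_le_of_le hκ₁ (iInf_le _ h₁))

end Minimizer

section Coupling

variable {t : ℝ} {C : X → ProbabilityMeasure Y → ℝ≥0∞}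

lemma weakCost_eq_kernelCost (ht : 1 ≤ t) (ν : PtSpace t Y) {μ : ProbabilityMeasure X}
    {κ : Kernel X Y} [IsMarkovKernel κ] (hκ : (μ : Measure X).bind κ = ν.1)
    {π : ProbabilityMeasure (X × Y)} (hπ : (π : Measure (X × Y)) = (μ : Measure X) ⊗ₘ κ) :
    weakCost C μ π = kernelCost (fun q => C q.1 q.2.1) ν (μ : Measure X) κ := by
  have hfst : (π : Measure (X × Y)).fst = μ := by rw [hπ, Measure.fst_compProd]
  have hcond := eq_condKernel_of_measure_eq_compProd (ρ := (π : Measure (X × Y))) κ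
    (by rw [hfst, hπ])
  rw [hfst] at hcond
  refine lintegral_congr_ae ?_
  filter_upwards [hcond, ae_memPt_of_bind ht ν hκ] with x hx hmem
  rw [toPt_of_memPt ν hmem]
  exact congrArg (C x) (Subtype.ext hx.symm)

end Coupling

/-- Existence of an optimizer for the weak transport problem (OWT). -/
theorem weak_transport_exists_minimizer
    (t : ℝ) (ht : 1 ≤ t) (C : X → ProbabilityMeasure Y → ℝ≥0∞)
    (hlsc : LowerSemicontinuous fun q : X × PtSpace t Y => C q.1 q.2.1)
    (hconv : ∀ x : X, ∀ p q r : ProbabilityMeasure Y, MemPt t p → MemPt t q →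
      ∀ a b : ℝ≥0, a + b = 1 →
      (r : Measure Y) = (a : ℝ≥0∞) • (p : Measure Y) + (b : ℝ≥0∞) • (q : Measure Y) →
      C x r ≤ (a : ℝ≥0∞) * C x p + (b : ℝ≥0∞) * C x q)
    (μ : ProbabilityMeasure X) (ν : ProbabilityMeasure Y) (hν : MemPt t ν) :
    ∃ π : ProbabilityMeasure (X × Y), IsCoupling μ ν π ∧
      ∀ π' : ProbabilityMeasure (X × Y), IsCoupling μ ν π' →
        weakCost C μ π ≤ weakCost C μ π' := by
  obtain ⟨κ, hM, hκ, hmin⟩ := exists_kernel_minimizer (μ := (μ : Measure X)) ht hlsc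
    (fun x p q r hr => by
      simpa using hconv x p.1 q.1 r.1 p.2 q.2 2⁻¹ 2⁻¹
        (by rw [← two_mul, mul_inv_cancel₀ two_ne_zero]) (by simpa using hr)) ⟨ν, hν⟩
  refine ⟨⟨(μ : Measure X) ⊗ₘ κ, inferInstance⟩, ⟨Measure.fst_compProd _ _, ?_⟩, fun π' hπ' => ?_⟩
  · exact (Measure.snd_compProd _ _).trans hκ
  · have hdis : (π' : Measure (X × Y)) = (μ : Measure X) ⊗ₘ (π' : Measure (X × Y)).condKernel := by
      conv_lhs => rw [← (π' : Measure (X × Y)).disintegrate (π' : Measure (X × Y)).condKernel]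
      rw [Measure.fst, hπ'.1]
    have hbind : (μ : Measure X).bind (π' : Measure (X × Y)).condKernel = ν := by
      rw [← Measure.snd_compProd, ← hdis]
      exact hπ'.2
    rw [weakCost_eq_kernelCost ht ⟨ν, hν⟩ hbind hdis]
    exact (weakCost_eq_kernelCost ht ⟨ν, hν⟩ hκ rfl).trans_le (hmin _ hbind)

end
end

section
/- Let X and Y be Polish spaces, t ≥ 1, and let C : X × P_t(Y) → ℝ ∪ {+∞} satisfy property (A). Then the map (μ,ν) ↦ V_C(μ,ν) = inf_{π ∈ Π(μ,ν)} ∫_X C(x,π_x) μ(dx) is lower semicontinuous on P(X) × P_t(Y), where P(X) carries the weak topology and P_t(Y) the t-Wasserstein topology. -/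
open MeasureTheory ProbabilityTheory ENNReal NNReal

noncomputable section

variable {X Y : Type*} [MetricSpace X] [PolishSpace X] [MeasurableSpace X] [BorelSpace X]
  [MetricSpace Y] [PolishSpace Y] [MeasurableSpace Y] [BorelSpace Y] [Nonempty Y]

/-- The value of the weak transport problem (OWT). -/
noncomputable def weakValue (C : X → ProbabilityMeasure Y → ℝ≥0∞)
    (μ : ProbabilityMeasure X) (ν : ProbabilityMeasure Y) : ℝ≥0∞ :=
  ⨅ (π : ProbabilityMeasure (X × Y)) (_ : IsCoupling μ ν π), weakCost C μ π

set_option linter.unusedSectionVars false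

open Filter Topology Set BoundedContinuousFunction

/-! ### The growth function -/

/-- The reference function `y ↦ 1 + d(y, y₀) ^ t` of growth of order `t`. -/
def growth (t : ℝ) (y₀ y : Y) : ℝ≥0 := 1 + nndist y y₀ ^ t

lemma one_le_growth (t : ℝ) (y₀ y : Y) : 1 ≤ growth t y₀ y := by
  simp [growth]

lemma growth_ne_zero (t : ℝ) (y₀ y : Y) : growth t y₀ y ≠ 0 :=
  (zero_lt_one.trans_le (one_le_growth t y₀ y)).ne'

lemma coe_growth (t : ℝ) (y₀ y : Y) : (growth t y₀ y : ℝ) = 1 + dist y y₀ ^ t := by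
  simp [growth]

lemma continuous_growth {t : ℝ} (ht : 0 ≤ t) (y₀ : Y) : Continuous (growth t y₀) := by
  unfold growth
  exact continuous_const.add
    ((NNReal.continuous_rpow_const ht).comp (continuous_id.nndist continuous_const))

lemma exists_growth_le_mul_growth {t : ℝ} (ht : 1 ≤ t) (a b : Y) :
    ∃ c : ℝ≥0, ∀ y, growth t a y ≤ c * growth t b y := by
  refine ⟨1 + 2 ^ (t - 1) * (1 + nndist b a ^ t), fun y => ?_⟩
  have h : nndist y a ^ t ≤ 2 ^ (t - 1) * (nndist y b ^ t + nndist b a ^ t) :=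
    (NNReal.rpow_le_rpow (nndist_triangle y b a) (by linarith)).trans
      (NNReal.rpow_add_le_mul_rpow_add_rpow _ _ ht)
  calc growth t a y ≤ 1 + 2 ^ (t - 1) * (nndist y b ^ t + nndist b a ^ t) := by
        unfold growth; gcongr
    _ ≤ (1 + nndist y b ^ t)
        + 2 ^ (t - 1) * ((1 + nndist b a ^ t) * (1 + nndist y b ^ t)) := by
        gcongr
        · simp
        · rw [mul_add, add_mul, add_mul]
          simp only [one_mul, mul_one]
          calc _ ≤ nndist y b ^ t + nndist b a ^ t + (1 + nndist b a ^ t * nndist y b ^ t) :=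
                le_self_add
            _ = _ := by ring
    _ = _ := by unfold growth; ring

lemma growth_mem_PhiT {t : ℝ} (ht : 0 ≤ t) (y₀ : Y) : (fun y => (growth t y₀ y : ℝ)) ∈ PhiT t Y :=
  ⟨NNReal.continuous_coe.comp (continuous_growth ht y₀), 1, y₀, fun y => by
    rw [abs_of_nonneg (NNReal.coe_nonneg _), one_mul, coe_growth]⟩

lemma exists_abs_le_mul_growth {t : ℝ} (ht : 1 ≤ t) (y₀ : Y) {g : Y → ℝ} (hg : g ∈ PhiT t Y) :
    ∃ c : ℝ, ∀ y, |g y| ≤ c * growth t y₀ y := by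
  obtain ⟨-, K, y₁, hK⟩ := hg
  obtain ⟨c, hc⟩ := exists_growth_le_mul_growth ht y₁ y₀
  refine ⟨|K| * c, fun y => ?_⟩
  calc |g y| ≤ |K| * growth t y₁ y := by
        rw [coe_growth]
        exact (hK y).trans (mul_le_mul_of_nonneg_right (le_abs_self K) (by positivity))
    _ ≤ |K| * (c * growth t y₀ y) := by gcongr; exact_mod_cast hc y
    _ = _ := by ring

lemma memPt_iff_integrable_growth {t : ℝ} (ht : 1 ≤ t) (y₀ : Y) {p : ProbabilityMeasure Y} :
    MemPt t p ↔ Integrable (fun y => (growth t y₀ y : ℝ)) (p : Measure Y) := by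
  constructor
  · rintro ⟨z, hz⟩
    obtain ⟨c, hc⟩ := exists_growth_le_mul_growth ht y₀ z
    have h1 : Integrable (fun y => (c : ℝ) * growth t z y) (p : Measure Y) := by
      simp only [coe_growth]
      exact ((integrable_const _).add hz).const_mul _
    refine h1.mono' (growth_mem_PhiT (by linarith) y₀).1.aestronglyMeasurable
      (.of_forall fun y => ?_)
    rw [Real.norm_of_nonneg (by positivity)]
    exact_mod_cast hc y
  · intro h
    refine ⟨y₀, ?_⟩
    convert h.sub (integrable_const (1 : ℝ)) using 2 with y
    simp [coe_growth]

lemma memPt_iff_lintegral_growth {t : ℝ} (ht : 1 ≤ t) (y₀ : Y) {p : ProbabilityMeasure Y} :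
    MemPt t p ↔ ∫⁻ y, growth t y₀ y ∂(p : Measure Y) ≠ ∞ := by
  rw [memPt_iff_integrable_growth ht y₀, ← lt_top_iff_ne_top]
  have hm := (growth_mem_PhiT (by linarith : 0 ≤ t) y₀).1.aestronglyMeasurable
    (μ := (p : Measure Y))
  rw [Integrable, and_iff_right hm, hasFiniteIntegral_iff_enorm]
  simp

lemma integrable_of_mem_PhiT {t : ℝ} (ht : 1 ≤ t) {g : Y → ℝ} (hg : g ∈ PhiT t Y)
    {p : ProbabilityMeasure Y} (hp : MemPt t p) : Integrable g (p : Measure Y) := by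
  obtain ⟨y₀⟩ := ‹Nonempty Y›
  obtain ⟨c, hc⟩ := exists_abs_le_mul_growth ht y₀ hg
  exact (((memPt_iff_integrable_growth ht y₀).1 hp).const_mul c).mono'
    hg.1.aestronglyMeasurable (.of_forall hc)

/-! ### The topology of `𝒫_t(Y)` -/

lemma PtSpace.isInducing_integral (t : ℝ) (Y : Type*) [MetricSpace Y] [MeasurableSpace Y] :
    IsInducing fun (p : PtSpace t Y) (g : PhiT t Y) => ∫ y, g.1 y ∂(p.1 : Measure Y) := by
  refine ⟨?_⟩
  simp only [Pi.topologicalSpace, induced_iInf, induced_compose]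
  change (⨅ g ∈ PhiT t Y, _) = _
  rw [iInf_subtype']
  rfl

lemma PtSpace.continuous_integral {t : ℝ} {g : Y → ℝ} (hg : g ∈ PhiT t Y) :
    Continuous fun p : PtSpace t Y => ∫ y, g y ∂(p.1 : Measure Y) :=
  (continuous_apply (⟨g, hg⟩ : PhiT t Y)).comp (PtSpace.isInducing_integral t Y).continuous

lemma PtSpace.continuous_rng_iff {t : ℝ} {W : Type*} [TopologicalSpace W] {f : W → PtSpace t Y} :
    Continuous f ↔ ∀ g ∈ PhiT t Y, Continuous fun w => ∫ y, g y ∂((f w).1 : Measure Y) := by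
  rw [(PtSpace.isInducing_integral t Y).continuous_iff, continuous_pi_iff]
  simp

lemma mul_mem_PhiT {t : ℝ} {f g : Y → ℝ} (hg : g ∈ PhiT t Y) (hf : Continuous f) {c : ℝ}
    (hc : ∀ y, |f y| ≤ c) : (fun y => g y * f y) ∈ PhiT t Y := by
  obtain ⟨hgc, K, y₀, hK⟩ := hg
  refine ⟨hgc.mul hf, K * c, y₀, fun y => ?_⟩
  rw [abs_mul, mul_right_comm]
  exact mul_le_mul (hK y) (hc y) (abs_nonneg _) ((abs_nonneg _).trans (hK y))

lemma boundedContinuousFunction_mem_PhiT {t : ℝ} (f : Y →ᵇ ℝ) : (f : Y → ℝ) ∈ PhiT t Y := by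
  obtain ⟨y₀⟩ := ‹Nonempty Y›
  refine ⟨f.continuous, ‖f‖, y₀, fun y => (f.norm_coe_le_norm y).trans ?_⟩
  exact le_mul_of_one_le_right (norm_nonneg f) (by simp; positivity)

lemma PtSpace.continuous_val {t : ℝ} :
    Continuous fun p : PtSpace t Y => p.1 :=
  ProbabilityMeasure.continuous_iff_forall_continuous_integral.2 fun f =>
    PtSpace.continuous_integral (boundedContinuousFunction_mem_PhiT f)

/-! ### Reweighting of measures -/

section Reweight

variable {Ω : Type*} [MeasurableSpace Ω]

/-- The probability measure with density proportional to `f` with respect to `p`. -/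
def reweight (f : Ω → ℝ≥0) (p : Measure Ω) : Measure Ω :=
  (∫⁻ ω, f ω ∂p)⁻¹ • p.withDensity fun ω => f ω

lemma isProbabilityMeasure_reweight {f : Ω → ℝ≥0} {p : Measure Ω}
    (h0 : ∫⁻ ω, f ω ∂p ≠ 0) (htop : ∫⁻ ω, f ω ∂p ≠ ∞) : IsProbabilityMeasure (reweight f p) := by
  constructor
  simp only [reweight, Measure.smul_apply, smul_eq_mul, withDensity_apply _ MeasurableSet.univ,
    Measure.restrict_univ]
  exact ENNReal.inv_mul_cancel h0 htop

lemma lintegral_reweight {f : Ω → ℝ≥0} (hf : Measurable f) (p : Measure Ω)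
    (g : Ω → ℝ≥0∞) : ∫⁻ ω, g ω ∂reweight f p = (∫⁻ ω, f ω ∂p)⁻¹ * ∫⁻ ω, f ω * g ω ∂p := by
  rw [reweight, lintegral_smul_measure, smul_eq_mul,
    lintegral_withDensity_eq_lintegral_mul_non_measurable _ (by fun_prop) (by simp)]
  rfl

lemma integral_reweight {f : Ω → ℝ≥0} (hf : Measurable f) (p : Measure Ω) (g : Ω → ℝ) :
    ∫ ω, g ω ∂reweight f p = (∫ ω, (f ω : ℝ) ∂p)⁻¹ * ∫ ω, f ω * g ω ∂p := by
  rw [reweight, integral_smul_measure, integral_withDensity_eq_integral_smul hf,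
    integral_eq_lintegral_of_nonneg_ae (.of_forall fun _ => NNReal.coe_nonneg _)
      (by fun_prop), ENNReal.toReal_inv]
  simp [NNReal.smul_def]

lemma lintegral_reweight_eq_of_mul_eq_one {f g : Ω → ℝ≥0} (hf : Measurable f)
    (hfg : ∀ ω, f ω * g ω = 1) (p : Measure Ω) [IsProbabilityMeasure p] :
    ∫⁻ ω, g ω ∂reweight f p = (∫⁻ ω, f ω ∂p)⁻¹ := by
  simp [lintegral_reweight hf, ← ENNReal.coe_mul, hfg]

lemma reweight_reweight {f g : Ω → ℝ≥0} (hf : Measurable f) (hg : Measurable g)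
    (hfg : ∀ ω, f ω * g ω = 1) (p : Measure Ω) [IsProbabilityMeasure p]
    (h0 : ∫⁻ ω, f ω ∂p ≠ 0) (htop : ∫⁻ ω, f ω ∂p ≠ ∞) : reweight g (reweight f p) = p := by
  have h1 := lintegral_reweight_eq_of_mul_eq_one hf hfg p
  rw [reweight, h1, reweight, withDensity_smul_measure, ← withDensity_mul _ (by fun_prop)
    (by fun_prop), smul_smul, inv_inv, ENNReal.mul_inv_cancel h0 htop, one_smul]
  have : ((fun ω => (f ω : ℝ≥0∞)) * fun ω => (g ω : ℝ≥0∞)) = 1 := by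
    ext ω; simp [← ENNReal.coe_mul, hfg]
  rw [this, withDensity_one]

lemma lintegral_coe_ne_zero {f : Ω → ℝ≥0} (hf : ∀ ω, f ω ≠ 0) (hfm : Measurable f)
    (p : Measure Ω) [IsProbabilityMeasure p] : ∫⁻ ω, f ω ∂p ≠ 0 := by
  rw [Ne, lintegral_eq_zero_iff (by fun_prop)]
  intro h
  obtain ⟨ω, hω⟩ := h.exists
  exact hf ω (by simpa using hω)

end Reweight

section Homeomorph

variable {t : ℝ}

lemma lintegral_inv_growth_le_one (t : ℝ) (y₀ : Y) (q : Measure Y) [IsProbabilityMeasure q] :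
    ∫⁻ y, ((growth t y₀ y)⁻¹ : ℝ≥0) ∂q ≤ 1 := by
  calc _ ≤ ∫⁻ _, 1 ∂q := lintegral_mono fun y => ENNReal.coe_le_one_iff.2 <| by
        exact inv_le_one_of_one_le₀ (one_le_growth t y₀ y)
    _ = 1 := by simp

/-- Reweighting by the growth function is a homeomorphism between `𝒫_t(Y)` with the
`t`-Wasserstein topology and `𝒫(Y)` with the weak topology. -/
def growthHomeomorph (ht : 1 ≤ t) (y₀ : Y) : PtSpace t Y ≃ₜ ProbabilityMeasure Y :=
  have hc : Continuous (growth t y₀) := continuous_growth (by linarith) y₀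
  have hci : Continuous fun y => (growth t y₀ y)⁻¹ := hc.inv₀ (growth_ne_zero t y₀)
  have h0 (p : ProbabilityMeasure Y) := lintegral_coe_ne_zero (growth_ne_zero t y₀) hc.measurable p
  have h0i (p : ProbabilityMeasure Y) := lintegral_coe_ne_zero
    (fun y => inv_ne_zero (growth_ne_zero t y₀ y)) hci.measurable p
  have htop (p : PtSpace t Y) := (memPt_iff_lintegral_growth ht y₀).1 p.2
  have htopi (q : ProbabilityMeasure Y) : ∫⁻ y, ((growth t y₀ y)⁻¹ : ℝ≥0) ∂(q : Measure Y) ≠ ∞ :=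
    ((lintegral_inv_growth_le_one t y₀ q).trans_lt ENNReal.one_lt_top).ne
  { toFun p := ⟨reweight (growth t y₀) p.1, isProbabilityMeasure_reweight (h0 p.1) (htop p)⟩
    invFun q := ⟨⟨reweight (fun y => (growth t y₀ y)⁻¹) q,
      isProbabilityMeasure_reweight (h0i q) (htopi q)⟩, (memPt_iff_lintegral_growth ht y₀).2 <| by
        change ∫⁻ y, growth t y₀ y ∂reweight (fun y => (growth t y₀ y)⁻¹) (q : Measure Y) ≠ ∞
        rw [lintegral_reweight_eq_of_mul_eq_one hci.measurable
          fun y => inv_mul_cancel₀ (growth_ne_zero t y₀ y)]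
        exact ENNReal.inv_ne_top.2 (h0i q)⟩
    left_inv p := Subtype.ext <| Subtype.ext <| reweight_reweight hc.measurable hci.measurable
      (fun y => mul_inv_cancel₀ (growth_ne_zero t y₀ y)) _ (h0 p.1) (htop p)
    right_inv q := Subtype.ext <| reweight_reweight hci.measurable hc.measurable
      (fun y => inv_mul_cancel₀ (growth_ne_zero t y₀ y)) _ (h0i q) (htopi q)
    continuous_toFun := by
      refine ProbabilityMeasure.continuous_iff_forall_continuous_integral.2 fun f => ?_
      change Continuous fun p : PtSpace t Y =>
        ∫ y, f y ∂reweight (growth t y₀) (p.1 : Measure Y)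
      rw [funext fun p : PtSpace t Y => integral_reweight hc.measurable (p.1 : Measure Y) f]
      have hg := growth_mem_PhiT (t := t) (by linarith) y₀
      refine (PtSpace.continuous_integral hg).inv₀ (fun p => ?_) |>.mul ?_
      · refine (zero_lt_one.trans_le ?_).ne'
        calc (1 : ℝ) = ∫ _, 1 ∂(p.1 : Measure Y) := by simp
          _ ≤ _ := integral_mono (integrable_const _) (integrable_of_mem_PhiT ht hg p.2)
            fun y => by exact_mod_cast one_le_growth t y₀ y
      · exact PtSpace.continuous_integral
          (mul_mem_PhiT hg f.continuous fun y => f.norm_coe_le_norm y)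
    continuous_invFun := by
      refine PtSpace.continuous_rng_iff.2 fun g hg => ?_
      change Continuous fun q : ProbabilityMeasure Y =>
        ∫ y, g y ∂reweight (fun y => (growth t y₀ y)⁻¹) (q : Measure Y)
      rw [funext fun q : ProbabilityMeasure Y => integral_reweight hci.measurable (q : Measure Y) g]
      have hcr : Continuous fun y => (((growth t y₀ y)⁻¹ : ℝ≥0) : ℝ) :=
        NNReal.continuous_coe.comp hci
      have hb (y : Y) : ‖(((growth t y₀ y)⁻¹ : ℝ≥0) : ℝ)‖ ≤ 1 := by
        rw [Real.norm_of_nonneg (NNReal.coe_nonneg _)]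
        exact_mod_cast inv_le_one_of_one_le₀ (one_le_growth t y₀ y)
      obtain ⟨c, hcg⟩ := exists_abs_le_mul_growth ht y₀ hg
      let φ : Y →ᵇ ℝ := .ofNormedAddCommGroup _ hcr 1 hb
      let ψ : Y →ᵇ ℝ := .ofNormedAddCommGroup _ (hcr.mul hg.1) c fun y => by
        rw [Pi.mul_apply, norm_mul, Real.norm_of_nonneg (NNReal.coe_nonneg _), NNReal.coe_inv,
          inv_mul_le_iff₀ (by exact_mod_cast zero_lt_one.trans_le (one_le_growth t y₀ y)), mul_comm]
        exact hcg y
      refine (ProbabilityMeasure.continuous_integral_boundedContinuousFunction φ).inv₀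
        (fun q => ?_) |>.mul (ProbabilityMeasure.continuous_integral_boundedContinuousFunction ψ)
      have := h0i q
      change ∫ y, (((growth t y₀ y)⁻¹ : ℝ≥0) : ℝ) ∂(q : Measure Y) ≠ 0
      rw [integral_eq_lintegral_of_nonneg_ae (.of_forall fun _ => NNReal.coe_nonneg _)
        hcr.aestronglyMeasurable]
      simp only [ENNReal.ofReal_coe_nnreal]
      exact ENNReal.toReal_ne_zero.2 ⟨this, htopi q⟩ }

lemma coe_growthHomeomorph (ht : 1 ≤ t) (y₀ : Y) (p : PtSpace t Y) :
    (growthHomeomorph ht y₀ p : Measure Y) = reweight (growth t y₀) p.1 := rfl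

lemma PtSpace.metrizableSpace (ht : 1 ≤ t) : TopologicalSpace.MetrizableSpace (PtSpace t Y) := by
  obtain ⟨y₀⟩ := ‹Nonempty Y›
  exact (growthHomeomorph ht y₀).isEmbedding.metrizableSpace

end Homeomorph

/-! ### Measurability and semicontinuity -/

lemma Topology.IsInducing.measurable_of_forall_measurable {W Z ι : Type*} [MeasurableSpace W]
    [TopologicalSpace Z] [SecondCountableTopology Z] [MeasurableSpace Z] [BorelSpace Z]
    {φ : Z → ι → ℝ} (hφ : IsInducing φ) {ξ : W → Z} (h : ∀ i, Measurable fun w => φ (ξ w) i) :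
    Measurable ξ := by
  have h1 : ‹TopologicalSpace Z› = .generateFrom (preimage φ '' {g | ∃ (s : ι → Set ℝ)
      (i : Finset ι), (∀ a ∈ i, IsOpen (s a)) ∧ g = (i : Set ι).pi s}) := by
    rw [hφ.eq_induced, pi_eq_generateFrom, induced_generateFrom_eq]
  rw [‹BorelSpace Z›.measurable_eq, borel_eq_generateFrom_of_subbasis h1]
  refine measurable_generateFrom ?_
  rintro _ ⟨_, ⟨s, i, hs, rfl⟩, rfl⟩
  have : ξ ⁻¹' (φ ⁻¹' (i : Set ι).pi s) = ⋂ a ∈ i, (fun w => φ (ξ w) a) ⁻¹' s a := by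
    ext; simp [Set.mem_pi]
  rw [this]
  exact Finset.measurableSet_biInter _ fun a ha => h a (hs a ha).measurableSet

lemma lintegral_le_liminf_lintegral_of_lowerSemicontinuous {E : Type*} [TopologicalSpace E]
    [MeasurableSpace E] [OpensMeasurableSpace E] [HasOuterApproxClosed E]
    {Q : ℕ → ProbabilityMeasure E} {Q₀ : ProbabilityMeasure E} (hQ : Tendsto Q atTop (𝓝 Q₀))
    {f : E → ℝ≥0∞} (hf : LowerSemicontinuous f) :
    ∫⁻ x, f x ∂(Q₀ : Measure E) ≤ liminf (fun n => ∫⁻ x, f x ∂(Q n : Measure E)) atTop := by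
  have key (m : ℕ) : ∫⁻ x, min (f x) m ∂(Q₀ : Measure E)
      ≤ liminf (fun n => ∫⁻ x, f x ∂(Q n : Measure E)) atTop := by
    set g : E → ℝ := fun x => (min (f x) m).toReal
    have hfin (x : E) : min (f x) m ≠ ∞ := (min_le_right _ _).trans_lt (by simp) |>.ne
    have hgm : Measurable g := (hf.measurable.min measurable_const).ennreal_toReal
    have hg (x : E) : min (f x) m = ENNReal.ofReal (g x) := (ENNReal.ofReal_toReal (hfin x)).symm
    have hopen (s : ℝ) (hs : 0 ≤ s) : IsOpen {x | s < g x} := by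
      have : {x | s < g x} = {x | ENNReal.ofReal s < f x} ∩ {_x | ENNReal.ofReal s < m} := by
        ext x
        simp only [g, mem_ofPred_eq, mem_inter_iff, ← lt_min_iff]
        exact (ENNReal.ofReal_lt_iff_lt_toReal hs (hfin x)).symm
      rw [this]
      exact (hf.isOpen_preimage _).inter isOpen_const
    have hcake (P : Measure E) :
        ∫⁻ x, min (f x) m ∂P = ∫⁻ s in Ioi (0 : ℝ), P {x | s < g x} := by
      simp_rw [hg]
      exact lintegral_eq_lintegral_meas_lt P (.of_forall fun _ => ENNReal.toReal_nonneg)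
        hgm.aemeasurable
    calc ∫⁻ x, min (f x) m ∂(Q₀ : Measure E)
        ≤ ∫⁻ s in Ioi (0 : ℝ), liminf (fun n => (Q n : Measure E) {x | s < g x}) atTop := by
          rw [hcake]
          refine setLIntegral_mono' measurableSet_Ioi fun s hs => ?_
          exact ProbabilityMeasure.le_liminf_measure_open_of_tendsto hQ (hopen s (le_of_lt hs))
      _ ≤ liminf (fun n => ∫⁻ s in Ioi (0 : ℝ), (Q n : Measure E) {x | s < g x}) atTop :=
          lintegral_liminf_le fun n => Antitone.measurable fun a b hab =>
            measure_mono fun x hx => lt_of_le_of_lt hab hx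
      _ ≤ _ := by
          simp_rw [← hcake]
          exact liminf_le_liminf (.of_forall fun n => lintegral_mono fun x => min_le_left _ _)
  have hsup (x : E) : f x = ⨆ m : ℕ, min (f x) m := by
    rw [← inf_iSup_eq, ENNReal.iSup_natCast, inf_top_eq]
  calc ∫⁻ x, f x ∂(Q₀ : Measure E) = ∫⁻ x, ⨆ m : ℕ, min (f x) m ∂(Q₀ : Measure E) := by
        simp_rw [← hsup]
    _ = ⨆ m : ℕ, ∫⁻ x, min (f x) m ∂(Q₀ : Measure E) :=
        lintegral_iSup (fun m => hf.measurable.min measurable_const)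
          fun a b hab x => min_le_min_left _ (by exact_mod_cast hab)
    _ ≤ _ := iSup_le key

/-! ### Tightness -/

lemma isTightMeasureSet_range_of_tendsto {E : Type*} [TopologicalSpace E] [PolishSpace E]
    [MeasurableSpace E] [BorelSpace E] {p : ℕ → ProbabilityMeasure E} {q : ProbabilityMeasure E}
    (h : Tendsto p atTop (𝓝 q)) :
    IsTightMeasureSet {μ : Measure E | ∃ n, (p n : Measure E) = μ} := by
  let := TopologicalSpace.upgradeIsCompletelyMetrizable E
  have := isTightMeasureSet_of_isCompact_closure (S := range p)
    (h.isCompact_insert_range.closure_of_subset (subset_insert _ _))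
  simpa only [exists_range_iff] using this

/-- A convergent sequence in `𝒫_t(Y)` has bounded integrals against a function all of whose
sublevel sets, as a functional on probability measures, are relatively compact in `𝒫_t(Y)`. -/
lemma exists_coercive_of_tendsto {t : ℝ} (ht : 1 ≤ t) {ν : ℕ → PtSpace t Y} {ν₀ : PtSpace t Y}
    (h : Tendsto ν atTop (𝓝 ν₀)) :
    ∃ (w : Y → ℝ≥0∞) (M : ℝ≥0∞) (K : ℕ → Set (PtSpace t Y)), Measurable w ∧ M ≠ ∞ ∧
      (∀ n, ∫⁻ y, w y ∂((ν n).1 : Measure Y) ≤ M) ∧ (∀ j, IsCompact (K j)) ∧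
      ∀ (j : ℕ) (p : ProbabilityMeasure Y), ∫⁻ y, w y ∂(p : Measure Y) ≤ j →
        ∃ hp : MemPt t p, (⟨p, hp⟩ : PtSpace t Y) ∈ K j := by
  obtain ⟨y₀⟩ := ‹Nonempty Y›
  have hc : Continuous (growth t y₀) := continuous_growth (by linarith) y₀
  have hgr := growth_mem_PhiT (t := t) (by linarith) y₀
  set T := growthHomeomorph ht y₀ with hT
  have hTapply (p : PtSpace t Y) {A : Set Y} (hA : MeasurableSet A) :
      (T p : Measure Y) A = (∫⁻ y, growth t y₀ y ∂(p.1 : Measure Y))⁻¹ *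
        ∫⁻ y in A, growth t y₀ y ∂(p.1 : Measure Y) := by
    rw [hT, coe_growthHomeomorph, reweight, Measure.smul_apply, withDensity_apply _ hA, smul_eq_mul]
  have hTν : Tendsto (fun n => T (ν n)) atTop (𝓝 (T ν₀)) := (T.continuous.tendsto ν₀).comp h
  have htight := isTightMeasureSet_iff_exists_isCompact_measure_compl_le.1
    (isTightMeasureSet_range_of_tendsto hTν)
  have hex (m : ℕ) : ∃ L : Set Y, IsCompact L ∧
      ∀ n, (T (ν n) : Measure Y) Lᶜ ≤ (2⁻¹ : ℝ≥0∞) ^ m * 2⁻¹ ^ m := by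
    obtain ⟨L, hL, h'⟩ := htight ((2⁻¹ : ℝ≥0∞) ^ m * 2⁻¹ ^ m) (by simp [pos_iff_ne_zero])
    exact ⟨L, hL, fun n => h' _ ⟨n, rfl⟩⟩
  choose L hLc hL using hex
  have hLm (m : ℕ) : MeasurableSet (L m)ᶜ := (hLc m).measurableSet.compl
  obtain ⟨M₀, hM₀⟩ : ∃ M₀ : ℝ≥0∞, M₀ ≠ ∞ ∧
      ∀ n, ∫⁻ y, growth t y₀ y ∂((ν n).1 : Measure Y) ≤ M₀ := by
    obtain ⟨B, hB⟩ := (((PtSpace.continuous_integral hgr).tendsto ν₀).comp h).bddAbove_range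
    refine ⟨ENNReal.ofReal B, ENNReal.ofReal_ne_top, fun n => ?_⟩
    have h1 := ofReal_integral_eq_lintegral_ofReal (integrable_of_mem_PhiT ht hgr (ν n).2)
      (.of_forall fun _ => NNReal.coe_nonneg _)
    simp only [ENNReal.ofReal_coe_nnreal] at h1
    rw [← h1]
    exact ENNReal.ofReal_le_ofReal (hB ⟨n, rfl⟩)
  have hν (n m : ℕ) : ∫⁻ y in (L m)ᶜ, growth t y₀ y ∂((ν n).1 : Measure Y)
      ≤ 2⁻¹ ^ m * 2⁻¹ ^ m * M₀ := by
    have h0 := lintegral_coe_ne_zero (growth_ne_zero t y₀) hc.measurable (ν n).1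
    have htop := (memPt_iff_lintegral_growth ht y₀).1 (ν n).2
    have := hL m n
    rw [hTapply _ (hLm m), mul_comm, ← div_eq_mul_inv, ENNReal.div_le_iff h0 htop] at this
    exact this.trans (by gcongr; exact hM₀.2 n)
  have hcoe : Measurable fun y => (growth t y₀ y : ℝ≥0∞) := by fun_prop
  have hwm : ∀ m : ℕ, Measurable ((L m)ᶜ.indicator fun y => (growth t y₀ y : ℝ≥0∞)) :=
    fun m => hcoe.indicator (hLm m)
  set w : Y → ℝ≥0∞ := fun y => growth t y₀ y +
    ∑' m : ℕ, 2 ^ m * (L m)ᶜ.indicator (fun y => (growth t y₀ y : ℝ≥0∞)) y with hw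
  have hint (p : Measure Y) : ∫⁻ y, w y ∂p = ∫⁻ y, growth t y₀ y ∂p +
      ∑' m : ℕ, 2 ^ m * ∫⁻ y in (L m)ᶜ, growth t y₀ y ∂p := by
    rw [hw, lintegral_add_left hcoe, lintegral_tsum fun m => ((hwm m).const_mul _).aemeasurable]
    congr 2 with m
    rw [lintegral_const_mul _ (hwm m), lintegral_indicator (hLm m)]
  have h22 (m : ℕ) : (2 : ℝ≥0∞) ^ m * 2⁻¹ ^ m = 1 := by
    rw [← mul_pow, ENNReal.mul_inv_cancel (by simp) (by simp), one_pow]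
  refine ⟨w, M₀ + 2 * M₀, fun j => T ⁻¹' {q | ∀ m, q (L m)ᶜ ≤ j * 2⁻¹ ^ m}, ?_, ?_, ?_, ?_, ?_⟩
  · exact hcoe.add (Measurable.tsum fun m => (hwm m).const_mul _)
  · simp [hM₀.1, ENNReal.mul_eq_top]
  · intro n
    rw [hint]
    gcongr
    · exact hM₀.2 n
    · calc _ ≤ ∑' m : ℕ, 2⁻¹ ^ m * M₀ := by
            refine ENNReal.tsum_le_tsum fun m => ?_
            calc _ ≤ (2 : ℝ≥0∞) ^ m * (2⁻¹ ^ m * 2⁻¹ ^ m * M₀) := by gcongr; exact hν n m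
              _ = 2 ^ m * 2⁻¹ ^ m * (2⁻¹ ^ m * M₀) := by ring
              _ = _ := by rw [h22, one_mul]
        _ = 2 * M₀ := by
            rw [ENNReal.tsum_mul_right, ENNReal.tsum_geometric, ENNReal.one_sub_inv_two, inv_inv]
  · intro j
    refine T.isCompact_preimage.2 ?_
    refine isCompact_setOfPred_probabilityMeasure_mass_eq_compl_isCompact_le ?_ hLc
      (.inl inferInstance)
    simpa using! (tendsto_pow_atTop_nhds_zero_of_lt_one (r := (2⁻¹ : ℝ≥0)) (by simp)
      (by rw [inv_lt_one₀] <;> norm_num)).const_mul (j : ℝ≥0)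
  · intro j p hp
    rw [hint] at hp
    have hfin := (le_self_add.trans hp).trans_lt (ENNReal.natCast_lt_top j)
    have hmem := (memPt_iff_lintegral_growth ht y₀).2 hfin.ne
    refine ⟨hmem, fun m => ?_⟩
    have h1 : (1 : ℝ≥0∞) ≤ ∫⁻ y, growth t y₀ y ∂(p : Measure Y) := by
      calc (1 : ℝ≥0∞) = ∫⁻ _, 1 ∂(p : Measure Y) := by simp
        _ ≤ _ := lintegral_mono fun y => ENNReal.one_le_coe_iff.2 (one_le_growth t y₀ y)
    have h2 : (2 : ℝ≥0∞) ^ m * ∫⁻ y in (L m)ᶜ, growth t y₀ y ∂(p : Measure Y) ≤ j :=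
      (ENNReal.le_tsum m).trans (le_add_self.trans hp)
    let p' : PtSpace t Y := ⟨p, hmem⟩
    change T p' (L m)ᶜ ≤ j * 2⁻¹ ^ m
    rw [← ENNReal.coe_le_coe, ProbabilityMeasure.ennreal_coeFn_eq_coeFn_toMeasure,
      hTapply p' (hLm m)]
    push_cast
    calc _ ≤ 1 * ∫⁻ y in (L m)ᶜ, growth t y₀ y ∂(p : Measure Y) := by
          gcongr; exact ENNReal.inv_le_one.2 h1
      _ = (2 ^ m * ∫⁻ y in (L m)ᶜ, growth t y₀ y ∂(p : Measure Y)) * 2⁻¹ ^ m := by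
          rw [mul_right_comm, h22]
      _ ≤ j * 2⁻¹ ^ m := by gcongr
      _ = _ := by simp

/-! ### Jensen's inequality -/

lemma integrable_integral_of_integrable_comp {Z Ω : Type*} [MeasurableSpace Z] [MeasurableSpace Ω]
    {κ : Kernel Z Ω} [IsSFiniteKernel κ] {m : Measure Z} [SFinite m] {g : Ω → ℝ}
    (hg : Integrable g (κ ∘ₘ m)) : Integrable (fun z => ∫ y, g y ∂κ z) m :=
  Integrable.integral_compProd (κ := Kernel.const Unit m) (η := Kernel.prodMkLeft Unit κ) (a := ())
    ((Measure.integrable_compProd_snd_iff hg.1).2 hg)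

lemma integral_integral_eq_integral_comp {Z Ω : Type*} [MeasurableSpace Z] [MeasurableSpace Ω]
    {κ : Kernel Z Ω} [IsSFiniteKernel κ] {m : Measure Z} [SFinite m] {g : Ω → ℝ}
    (hg : Integrable g (κ ∘ₘ m)) : ∫ z, ∫ y, g y ∂κ z ∂m = ∫ y, g y ∂(κ ∘ₘ m) := by
  rw [← Measure.integral_compProd ((Measure.integrable_compProd_snd_iff hg.1).2 hg),
    ← Measure.snd_compProd, Measure.snd, integral_map measurable_snd.aemeasurable]
  rw [← Measure.snd, Measure.snd_compProd]
  exact hg.1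

lemma PtSpace.exists_convexCombination {t : ℝ} (ht : 1 ≤ t) (p q : PtSpace t Y) {a b : ℝ≥0}
    (hab : a + b = 1) : ∃ r : PtSpace t Y,
      (r.1 : Measure Y) = (a : ℝ≥0∞) • (p.1 : Measure Y) + (b : ℝ≥0∞) • (q.1 : Measure Y) := by
  obtain ⟨y₀⟩ := ‹Nonempty Y›
  refine ⟨⟨⟨(a : ℝ≥0∞) • (p.1 : Measure Y) + (b : ℝ≥0∞) • (q.1 : Measure Y), ⟨?_⟩⟩,
    (memPt_iff_lintegral_growth ht y₀).2 ?_⟩, rfl⟩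
  · simp [← ENNReal.coe_add, hab]
  · change ∫⁻ y, growth t y₀ y
      ∂((a : ℝ≥0∞) • (p.1 : Measure Y) + (b : ℝ≥0∞) • (q.1 : Measure Y)) ≠ ∞
    rw [lintegral_add_measure, lintegral_smul_measure, lintegral_smul_measure]
    exact ENNReal.add_ne_top.2
      ⟨ENNReal.mul_ne_top ENNReal.coe_ne_top ((memPt_iff_lintegral_growth ht y₀).1 p.2),
        ENNReal.mul_ne_top ENNReal.coe_ne_top ((memPt_iff_lintegral_growth ht y₀).1 q.2)⟩

/-- Jensen's inequality for a lower semicontinuous convex functional on `𝒫_t(Y)`. -/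
lemma le_lintegral_of_lowerSemicontinuous_of_convex {t : ℝ} (ht : 1 ≤ t)
    {F : ProbabilityMeasure Y → ℝ≥0∞} (hF : LowerSemicontinuous fun p : PtSpace t Y => F p.1)
    (hconv : ∀ p q r : ProbabilityMeasure Y, MemPt t p → MemPt t q → ∀ a b : ℝ≥0, a + b = 1 →
      (r : Measure Y) = (a : ℝ≥0∞) • (p : Measure Y) + (b : ℝ≥0∞) • (q : Measure Y) →
      F r ≤ (a : ℝ≥0∞) * F p + (b : ℝ≥0∞) * F q)
    {Z : Type*} [MeasurableSpace Z] {S : Z → PtSpace t Y} {κ : Kernel Z Y} [IsMarkovKernel κ]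
    (hκ : ∀ z, κ z = ((S z).1 : Measure Y)) {m : Measure Z} [IsProbabilityMeasure m]
    (hm : Measurable fun z => F (S z).1) {q : PtSpace t Y} (hq : (q.1 : Measure Y) = κ ∘ₘ m) :
    F q.1 ≤ ∫⁻ z, F (S z).1 ∂m := by
  by_contra! h
  obtain ⟨c, hc1, hc2⟩ := exists_between h
  have hN : {p : PtSpace t Y | c < F p.1} ∈ 𝓝 q := hF q c hc2
  rw [(PtSpace.isInducing_integral t Y).nhds_eq_comap, mem_comap] at hN
  obtain ⟨V, hV, hVsub⟩ := hN
  rw [nhds_pi, Filter.mem_pi] at hV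
  obtain ⟨I, hI, U, hU, hUV⟩ := hV
  have := hI.fintype
  let Φ (p : PtSpace t Y) (i : I) : ℝ := ∫ y, i.1.1 y ∂(p.1 : Measure Y)
  let A : Set ((I → ℝ) × ℝ) :=
    {e | ∃ p : PtSpace t Y, e.1 = Φ p ∧ 0 ≤ e.2 ∧ F p.1 ≤ ENNReal.ofReal e.2}
  have hA : Convex ℝ A := by
    rintro e ⟨p, hp1, hp2, hp3⟩ e' ⟨p', hp1', hp2', hp3'⟩ a b ha hb hab
    lift a to ℝ≥0 using ha
    lift b to ℝ≥0 using hb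
    have hab : a + b = 1 := by exact_mod_cast hab
    obtain ⟨r, hr⟩ := PtSpace.exists_convexCombination ht p p' hab
    refine ⟨r, ?_, ?_, ?_⟩
    · ext i
      have h1 := (integrable_of_mem_PhiT ht i.1.2 p.2).smul_measure (c := a) ENNReal.coe_ne_top
      have h2 := (integrable_of_mem_PhiT ht i.1.2 p'.2).smul_measure (c := b) ENNReal.coe_ne_top
      simp only [Φ, hr]
      rw [integral_add_measure h1 h2, integral_smul_measure, integral_smul_measure]
      simp [hp1, hp1', Φ]
    · simp only [Prod.snd_add, Prod.smul_snd, smul_eq_mul]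
      positivity
    · refine (hconv _ _ _ p.2 p'.2 a b hab hr).trans ?_
      simp only [Prod.snd_add, Prod.smul_snd, smul_eq_mul]
      rw [ENNReal.ofReal_add (by positivity) (by positivity), ENNReal.ofReal_mul (by positivity),
        ENNReal.ofReal_mul (by positivity), ENNReal.ofReal_coe_nnreal, ENNReal.ofReal_coe_nnreal]
      gcongr
  have hI : ∫⁻ z, F (S z).1 ∂m ≠ ∞ := (h.trans_le le_top).ne
  have hint (i : I) : Integrable i.1.1 (κ ∘ₘ m) := hq ▸ integrable_of_mem_PhiT ht i.1.2 q.2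
  have hΦ (i : I) : Integrable (fun z => Φ (S z) i) m := by
    simpa only [hκ] using integrable_integral_of_integrable_comp (hint i)
  have hFS : Integrable (fun z => (F (S z).1).toReal) m :=
    integrable_toReal_of_lintegral_ne_top hm.aemeasurable hI
  have hmem : ∫ z, (Φ (S z), (F (S z).1).toReal) ∂m ∈ closure A := by
    refine hA.closure.integral_mem isClosed_closure ?_ ((Integrable.of_eval hΦ).prodMk hFS)
    filter_upwards [ae_lt_top hm hI] with z hz
    exact subset_closure ⟨S z, rfl, ENNReal.toReal_nonneg, (ENNReal.ofReal_toReal hz.ne).ge⟩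
  have hbox (i : I) : U i ∈ 𝓝 ((∫ z, Φ (S z) ∂m) i) := by
    have : (∫ z, Φ (S z) ∂m) i = ∫ y, i.1.1 y ∂(q.1 : Measure Y) := by
      rw [eval_integral hΦ, hq, ← integral_integral_eq_integral_comp (hint i)]
      simp only [hκ, Φ]
    rw [this]
    exact hU i
  rw [integral_pair (Integrable.of_eval hΦ) hFS, integral_toReal hm.aemeasurable (ae_lt_top hm hI),
    mem_closure_iff_nhds] at hmem
  obtain ⟨e, ⟨he1, he2⟩, p, hp1, hp2, hp3⟩ := hmem
    ((univ.pi fun i : I => U i) ×ˢ Iio c.toReal) (prod_mem_nhds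
      (set_pi_mem_nhds finite_univ fun i _ => hbox i)
      (Iio_mem_nhds ((ENNReal.toReal_lt_toReal hI (hc2.trans_le le_top).ne).2 hc1)))
  have h1 : c < F p.1 := hVsub <| hUV fun i hi => by
    have := he1 ⟨i, hi⟩ (mem_univ _)
    rwa [hp1] at this
  exact h1.not_ge <| hp3.trans <|
    (ENNReal.ofReal_le_iff_le_toReal (hc2.trans_le le_top).ne).2 (le_of_lt he2)

/-! ### Parametrizing measures by a Polish space -/

lemma PtSpace.measurable_coe {t : ℝ} {Z : Type*} [TopologicalSpace Z] [MeasurableSpace Z]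
    [OpensMeasurableSpace Z] {S : Z → PtSpace t Y} (hS : Continuous S) :
    Measurable fun z => ((S z).1 : Measure Y) := by
  refine Measurable.measure_of_isPiSystem_of_isProbabilityMeasure
    (BorelSpace.measurable_eq (α := Y)) isPiSystem_isOpen fun G hG => ?_
  have : LowerSemicontinuous fun z => ((S z).1 : Measure Y) G := by
    rw [lowerSemicontinuous_iff_le_liminf]
    exact fun z => ProbabilityMeasure.le_liminf_measure_open_of_tendsto
      ((PtSpace.continuous_val.comp hS).tendsto z) hG
  exact this.measurable

/-- A countable family of compact metrizable sets is the image of the levels of a Polish space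
whose topology is induced by the level and the underlying point. -/
lemma exists_polishSpace_of_isCompact.{u} {T : Type u} [TopologicalSpace T]
    [TopologicalSpace.MetrizableSpace T] {K : ℕ → Set T} (hK : ∀ j, IsCompact (K j)) :
    ∃ (Z : Type u) (_ : TopologicalSpace Z) (_ : PolishSpace Z) (lev : Z → ℕ) (S : Z → T),
      IsInducing (fun z => (lev z, S z)) ∧ (∀ J, IsCompact {z | lev z ≤ J}) ∧
        ∀ j, ∀ p ∈ K j, ∃ z, lev z = j ∧ S z = p := by
  have (j : ℕ) : CompactSpace (K j) := isCompact_iff_compactSpace.1 (hK j)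
  let (j : ℕ) : MetricSpace (K j) := TopologicalSpace.metrizableSpaceMetric (K j)
  refine ⟨Σ j, K j, inferInstance, inferInstance, fun z => z.1, fun z => z.2, ?_, fun J => ?_,
    fun j p hp => ⟨⟨j, p, hp⟩, rfl, rfl⟩⟩
  · rw [isInducing_iff_nhds]
    rintro ⟨j, p⟩
    rw [Sigma.nhds_mk, nhds_prod_eq, nhds_discrete ℕ, pure_prod,
      IsInducing.subtypeVal.nhds_eq_comap]
    ext s
    simp only [mem_map, mem_comap]
    constructor
    · rintro ⟨u, hu, hus⟩
      refine ⟨Prod.mk j '' u, image_mem_map hu, ?_⟩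
      rintro ⟨j', p'⟩ ⟨v, hv, hvp⟩
      obtain ⟨rfl, rfl⟩ := Prod.mk.inj hvp
      exact hus hv
    · rintro ⟨u, hu, hus⟩
      exact ⟨Prod.mk j ⁻¹' u, hu, fun p' hp' => hus hp'⟩
  · have : {z : Σ j, K j | z.1 ≤ J} = ⋃ j ∈ Finset.range (J + 1), Sigma.mk j '' univ := by
      ext ⟨j, p⟩
      simp
    rw [this]
    exact Finset.isCompact_biUnion _ fun j _ => isCompact_univ.image continuous_sigmaMk

lemma exists_polishSpace_of_tendsto.{u} {Y : Type u} [MetricSpace Y] [PolishSpace Y]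
    [MeasurableSpace Y] [BorelSpace Y] [Nonempty Y] {t : ℝ} (ht : 1 ≤ t)
    {ν : ℕ → PtSpace t Y} {ν₀ : PtSpace t Y}
    (h : Tendsto ν atTop (𝓝 ν₀)) :
    ∃ (w : Y → ℝ≥0∞) (M : ℝ≥0∞) (Z : Type u) (_ : TopologicalSpace Z) (_ : PolishSpace Z)
      (lev : Z → ℕ) (S : Z → PtSpace t Y), Measurable w ∧ M ≠ ∞ ∧
      (∀ n, ∫⁻ y, w y ∂((ν n).1 : Measure Y) ≤ M) ∧
      IsInducing (fun z => (lev z, S z)) ∧ (∀ J, IsCompact {z | lev z ≤ J}) ∧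
      ∀ p : ProbabilityMeasure Y, ∫⁻ y, w y ∂(p : Measure Y) ≠ ∞ →
        ∃ z, lev z = ⌈(∫⁻ y, w y ∂(p : Measure Y)).toReal⌉₊ ∧ (S z).1 = p := by
  have := PtSpace.metrizableSpace (Y := Y) ht
  obtain ⟨w, M, K, hw, hM, hν, hK, hwK⟩ := exists_coercive_of_tendsto ht h
  obtain ⟨Z, _, _, lev, S, hS, hZ, hsurj⟩ := exists_polishSpace_of_isCompact hK
  refine ⟨w, M, Z, inferInstance, inferInstance, lev, S, hw, hM, hν, hS, hZ, fun p hp => ?_⟩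
  obtain ⟨hp', hpK⟩ := hwK ⌈(∫⁻ y, w y ∂(p : Measure Y)).toReal⌉₊ p <| by
    rw [← ENNReal.ofReal_natCast]
    exact (ENNReal.le_ofReal_iff_toReal_le hp (by positivity)).2 (Nat.le_ceil _)
  obtain ⟨z, hz1, hz2⟩ := hsurj _ _ hpK
  exact ⟨z, hz1, congrArg Subtype.val hz2⟩

/-- The disintegration of a coupling factors measurably through a parametrization of `𝒫_t(Y)`. -/
lemma exists_measurable_disint_eq {t : ℝ} {w : Y → ℝ≥0∞} (hw : Measurable w)
    {Z : Type*} [TopologicalSpace Z] [SecondCountableTopology Z] [MeasurableSpace Z] [BorelSpace Z]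
    {lev : Z → ℕ} {S : Z → PtSpace t Y} (hS : IsInducing fun z => (lev z, S z))
    (hsurj : ∀ p : ProbabilityMeasure Y, ∫⁻ y, w y ∂(p : Measure Y) ≠ ∞ →
        ∃ z, lev z = ⌈(∫⁻ y, w y ∂(p : Measure Y)).toReal⌉₊ ∧ (S z).1 = p)
    {μ : ProbabilityMeasure X} {ν : ProbabilityMeasure Y} {π : ProbabilityMeasure (X × Y)}
    (hπ : IsCoupling μ ν π) (hν : ∫⁻ y, w y ∂(ν : Measure Y) ≠ ∞) :
    ∃ ξ : X → Z, Measurable ξ ∧ (∀ᵐ x ∂(μ : Measure X), (S (ξ x)).1 = disint π x) ∧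
      ∫⁻ x, lev (ξ x) ∂(μ : Measure X) ≤ ∫⁻ y, w y ∂(ν : Measure Y) + 1 := by
  let κ := (π : Measure (X × Y)).condKernel
  let r (x : X) : ℝ≥0∞ := ∫⁻ y, w y ∂κ x
  have hr : Measurable r := hw.lintegral_kernel
  have hrμ : ∫⁻ x, r x ∂(μ : Measure X) = ∫⁻ y, w y ∂(ν : Measure Y) := by
    rw [← hπ.2, ← hπ.1, lintegral_map hw measurable_snd]
    exact Measure.lintegral_condKernel (hw.comp measurable_snd)
  obtain ⟨z₀, -⟩ := hsurj ν hν
  have hex (x : X) : ∃ z, if r x = ∞ then z = z₀ else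
      lev z = ⌈(r x).toReal⌉₊ ∧ (S z).1 = disint π x := by
    split_ifs with h
    · exact ⟨z₀, rfl⟩
    · exact hsurj (disint π x) h
  choose ξ hξ using hex
  have htop (x : X) (h : r x = ∞) : ξ x = z₀ := by simpa [h] using hξ x
  have hfin (x : X) (h : r x ≠ ∞) : lev (ξ x) = ⌈(r x).toReal⌉₊ ∧ (S (ξ x)).1 = disint π x := by
    simpa [h] using hξ x
  have hset : MeasurableSet {x | r x = ∞} := hr (measurableSet_singleton _)
  have hae : ∀ᵐ x ∂(μ : Measure X), r x ≠ ∞ := by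
    filter_upwards [ae_lt_top hr (hrμ.trans_ne hν)] with x hx using hx.ne
  refine ⟨ξ, ?_, hae.mono fun x hx => (hfin x hx).2, ?_⟩
  · let φ (z : Z) : Option (PhiT t Y) → ℝ
      | none => lev z
      | some g => ∫ y, g.1 y ∂((S z).1 : Measure Y)
    have hφ : IsInducing φ := by
      refine ⟨hS.eq_induced.trans ?_⟩
      simp only [Pi.topologicalSpace, iInf_option, induced_inf, induced_iInf, induced_compose]
      rw [instTopologicalSpaceProd, induced_inf, induced_compose, induced_compose,
        (PtSpace.isInducing_integral t Y).eq_induced,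
        Nat.isClosedEmbedding_coe_real.isInducing.eq_induced]
      simp only [Pi.topologicalSpace, induced_iInf, induced_compose]
      rfl
    refine hφ.measurable_of_forall_measurable fun i => ?_
    classical
    rcases i with _ | g
    · have : (fun x => φ (ξ x) none) =
          fun x => if r x = ∞ then (lev z₀ : ℝ) else (⌈(r x).toReal⌉₊ : ℝ) := by
        ext x
        split_ifs with h
        · simp only [φ, htop x h]
        · simp only [φ, (hfin x h).1]
      rw [this]
      exact Measurable.ite hset measurable_const
        (measurable_from_nat.comp (Nat.measurable_ceil.comp hr.ennreal_toReal))
    · have : (fun x => φ (ξ x) (some g)) = fun x => if r x = ∞ then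
          ∫ y, g.1 y ∂((S z₀).1 : Measure Y) else ∫ y, g.1 y ∂κ x := by
        ext x
        split_ifs with h
        · simp only [φ, htop x h]
        · simp only [φ, (hfin x h).2]
          rfl
      rw [this]
      exact Measurable.ite hset measurable_const
        (g.2.1.stronglyMeasurable.integral_kernel).measurable
  · calc ∫⁻ x, lev (ξ x) ∂(μ : Measure X) ≤ ∫⁻ x, (r x + 1) ∂(μ : Measure X) := by
          refine lintegral_mono_ae (hae.mono fun x hx => ?_)
          rw [(hfin x hx).1, ← ENNReal.ofReal_natCast]
          refine (ENNReal.ofReal_le_ofReal (Nat.ceil_lt_add_one ENNReal.toReal_nonneg).le).trans ?_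
          rw [ENNReal.ofReal_add ENNReal.toReal_nonneg zero_le_one, ENNReal.ofReal_toReal hx,
            ENNReal.ofReal_one]
      _ = _ := by rw [lintegral_add_right _ measurable_const, hrμ]; simp

/-! ### Compactness of lifted couplings -/

lemma isTightMeasureSet_of_lintegral_le {Z : Type*} [TopologicalSpace Z] [MeasurableSpace Z]
    {lev : Z → ℕ} (hlev : Measurable lev) (hZ : ∀ J, IsCompact {z | lev z ≤ J}) {M : ℝ≥0∞}
    (hM : M ≠ ∞) {A : Set (Measure Z)} (hA : ∀ m ∈ A, ∫⁻ z, lev z ∂m ≤ M) :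
    IsTightMeasureSet A := by
  rw [isTightMeasureSet_iff_exists_isCompact_measure_compl_le]
  intro ε hε
  obtain ⟨J, hJ⟩ := ENNReal.exists_nat_mul_gt hε.ne' hM
  have hJ0 : (J : ℝ≥0∞) ≠ 0 := by
    rintro h
    simp [h] at hJ
  refine ⟨_, hZ J, fun m hm => ?_⟩
  have hmark := meas_ge_le_lintegral_div (μ := m)
    (f := fun z => (lev z : ℝ≥0∞)) (measurable_from_nat.comp hlev).aemeasurable hJ0 (by simp)
  refine ((measure_mono fun z hz => ?_).trans hmark).trans ?_
  · simp only [mem_compl_iff, mem_ofPred_eq, not_le] at hz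
    exact Nat.cast_le (α := ℝ≥0∞).2 hz.le
  · refine ENNReal.div_le_of_le_mul' ((hA m hm).trans hJ.le)

lemma exists_tendsto_subseq_of_lintegral_le {Z : Type*} [TopologicalSpace Z] [PolishSpace Z]
    [MeasurableSpace Z] [BorelSpace Z] {lev : Z → ℕ} (hlev : Measurable lev)
    (hZ : ∀ J, IsCompact {z | lev z ≤ J}) {μ : ℕ → ProbabilityMeasure X} {μ₀ : ProbabilityMeasure X}
    (hμ : Tendsto μ atTop (𝓝 μ₀)) {Q : ℕ → ProbabilityMeasure (X × Z)}
    (hQ : ∀ n, (Q n : Measure (X × Z)).fst = μ n) {M : ℝ≥0∞} (hM : M ≠ ∞)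
    (hQM : ∀ n, ∫⁻ z, lev z ∂(Q n : Measure (X × Z)).snd ≤ M) :
    ∃ (Q₀ : ProbabilityMeasure (X × Z)) (φ : ℕ → ℕ), StrictMono φ ∧
      Tendsto (fun n => Q (φ n)) atTop (𝓝 Q₀) := by
  have htight : IsTightMeasureSet {((q : ProbabilityMeasure (X × Z)) : Measure (X × Z)) |
      q ∈ range Q} := by
    refine IsTightMeasureSet.prodMk ?_
      (isTightMeasureSet_of_lintegral_le hlev hZ hM ?_)
    · refine (isTightMeasureSet_range_of_tendsto hμ).subset ?_
      rintro _ ⟨_, ⟨_, ⟨n, rfl⟩, rfl⟩, rfl⟩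
      exact ⟨n, (hQ n).symm⟩
    · rintro _ ⟨_, ⟨_, ⟨n, rfl⟩, rfl⟩, rfl⟩
      exact hQM n
  obtain ⟨Q₀, -, φ, hφ, hlim⟩ := (isCompact_closure_of_isTightMeasureSet htight).tendsto_subseq
    fun n => subset_closure (mem_range_self n)
  exact ⟨Q₀, φ, hφ, hlim⟩

lemma comp_snd_map_eq {Z : Type*} [MeasurableSpace Z] {κ : Kernel Z Y} {μ : ProbabilityMeasure X}
    {ν : ProbabilityMeasure Y} {π : ProbabilityMeasure (X × Y)} (hπ : IsCoupling μ ν π) {ξ : X → Z}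
    (hξ : Measurable ξ) (h : ∀ᵐ x ∂(μ : Measure X), κ (ξ x) = (disint π x : Measure Y)) :
    κ ∘ₘ (μ : Measure X).map ξ = ν := by
  ext s hs
  rw [Measure.bind_apply hs κ.measurable.aemeasurable,
    lintegral_map (κ.measurable_coe hs) hξ, lintegral_congr_ae (h.mono fun x hx => by rw [hx]),
    ← hπ.2, ← hπ.1, Measure.map_apply measurable_snd hs, ← lintegral_indicator_one
      (measurable_snd hs), ← Measure.lintegral_condKernel]
  · refine lintegral_congr fun x => ?_
    exact (lintegral_indicator_one hs).symm
  · exact measurable_one.indicator (measurable_snd hs)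

lemma tendsto_comp_of_continuous {Z : Type*} [TopologicalSpace Z] [MeasurableSpace Z]
    [OpensMeasurableSpace Z] {t : ℝ} {S : Z → PtSpace t Y} (hS : Continuous S) {κ : Kernel Z Y}
    [IsMarkovKernel κ] (hκ : ∀ z, κ z = ((S z).1 : Measure Y)) {m : ℕ → ProbabilityMeasure Z}
    {m₀ : ProbabilityMeasure Z} (hm : Tendsto m atTop (𝓝 m₀)) {ν : ℕ → ProbabilityMeasure Y}
    {ν₀ : ProbabilityMeasure Y} (hν : Tendsto ν atTop (𝓝 ν₀))
    (h : ∀ n, (ν n : Measure Y) = κ ∘ₘ (m n : Measure Z)) :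
    (ν₀ : Measure Y) = κ ∘ₘ (m₀ : Measure Z) := by
  let ν' : ProbabilityMeasure Y := ⟨κ ∘ₘ (m₀ : Measure Z), inferInstance⟩
  suffices Tendsto ν atTop (𝓝 ν') by rw [tendsto_nhds_unique hν this]; rfl
  rw [ProbabilityMeasure.tendsto_iff_forall_integral_tendsto]
  intro f
  let g : Z →ᵇ ℝ := .ofNormedAddCommGroup (fun z => ∫ y, f y ∂((S z).1 : Measure Y))
    ((PtSpace.continuous_integral (boundedContinuousFunction_mem_PhiT f)).comp hS) ‖f‖
    fun z => f.norm_integral_le_norm _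
  have hint (m : ProbabilityMeasure Z) :
      ∫ y, f y ∂(κ ∘ₘ (m : Measure Z)) = ∫ z, g z ∂(m : Measure Z) := by
    rw [← integral_integral_eq_integral_comp (f.integrable _)]
    simp only [hκ]
    rfl
  have := ProbabilityMeasure.tendsto_iff_forall_integral_tendsto.1 hm g
  simp only [← hint, ← h] at this
  exact this

/-! ### Lower semicontinuity -/

/-- Couplings of bounded weak transport cost have a limiting coupling obeying the same bound. -/
lemma exists_isCoupling_weakCost_le_of_tendsto {t : ℝ} (ht : 1 ≤ t)
    {C : X → ProbabilityMeasure Y → ℝ≥0∞}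
    (hlsc : LowerSemicontinuous fun q : X × PtSpace t Y => C q.1 q.2.1)
    (hconv : ∀ x : X, ∀ p q r : ProbabilityMeasure Y, MemPt t p → MemPt t q →
      ∀ a b : ℝ≥0, a + b = 1 →
      (r : Measure Y) = (a : ℝ≥0∞) • (p : Measure Y) + (b : ℝ≥0∞) • (q : Measure Y) →
      C x r ≤ (a : ℝ≥0∞) * C x p + (b : ℝ≥0∞) * C x q)
    {μ : ℕ → ProbabilityMeasure X} {μ₀ : ProbabilityMeasure X} (hμ : Tendsto μ atTop (𝓝 μ₀))
    {ν : ℕ → PtSpace t Y} {ν₀ : PtSpace t Y} (hν : Tendsto ν atTop (𝓝 ν₀))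
    {π : ℕ → ProbabilityMeasure (X × Y)} (hπ : ∀ n, IsCoupling (μ n) (ν n).1 (π n))
    {c : ℝ≥0∞} (hc : ∀ n, weakCost C (μ n) (π n) ≤ c) :
    ∃ π₀ : ProbabilityMeasure (X × Y), IsCoupling μ₀ ν₀.1 π₀ ∧ weakCost C μ₀ π₀ ≤ c := by
  obtain ⟨y₀⟩ := ‹Nonempty Y›
  obtain ⟨w, M, Z, _, _, lev, S, hw, hM, hνM, hS, hZ, hsurj⟩ := exists_polishSpace_of_tendsto ht hν
  let := TopologicalSpace.upgradeIsCompletelyMetrizable Z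
  let : MeasurableSpace Z := borel Z
  have : BorelSpace Z := ⟨rfl⟩
  have hνfin (n : ℕ) := ((hνM n).trans_lt hM.lt_top).ne
  choose ξ hξm hξ hξM using fun n => exists_measurable_disint_eq hw hS hsurj (hπ n) (hνfin n)
  have hSc : Continuous S := continuous_snd.comp hS.continuous
  have hlev : Continuous lev := continuous_fst.comp hS.continuous
  have : Nonempty Z := ⟨(hsurj _ (hνfin 0)).choose⟩
  have hpair (n : ℕ) : Measurable fun x => (x, ξ n x) := measurable_id.prodMk (hξm n)
  let Q (n : ℕ) : ProbabilityMeasure (X × Z) := (μ n).map (hpair n).aemeasurable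
  have hQ (n : ℕ) : (Q n : Measure (X × Z)) = (μ n : Measure X).map fun x => (x, ξ n x) := rfl
  have hQfst (n : ℕ) : (Q n : Measure (X × Z)).fst = μ n := by
    rw [hQ, Measure.fst_map_prodMk (hξm n), Measure.map_id']
  have hQsnd (n : ℕ) : (Q n : Measure (X × Z)).snd = (μ n : Measure X).map (ξ n) := by
    rw [hQ, Measure.snd_map_prodMk measurable_id']
  obtain ⟨Q₀, φ, hφ, hlim⟩ := exists_tendsto_subseq_of_lintegral_le hlev.measurable hZ hμ hQfst
    (M := M + 1) (by simp [hM]) fun n => by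
      rw [hQsnd, lintegral_map (f := fun z => (lev z : ℝ≥0∞))
        (measurable_from_nat.comp hlev.measurable) (hξm n)]
      exact (hξM n).trans (by gcongr; exact hνM n)
  have hQ₀ : (Q₀ : Measure (X × Z)).fst = μ₀ := by
    have h1 := ProbabilityMeasure.tendsto_map_of_tendsto_of_continuous _ _ hlim continuous_fst
    have h2 (n : ℕ) : (Q (φ n)).map continuous_fst.measurable.aemeasurable = μ (φ n) :=
      Subtype.ext (hQfst (φ n))
    simp only [h2] at h1
    rw [← tendsto_nhds_unique h1 (hμ.comp hφ.tendsto_atTop)]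
    rfl
  let P : Kernel Z Y := ⟨fun z => (S z).1, PtSpace.measurable_coe hSc⟩
  have hP (z : Z) : P z = ((S z).1 : Measure Y) := rfl
  have : IsMarkovKernel P := ⟨fun z => by rw [hP]; infer_instance⟩
  have hν₀ : (ν₀.1 : Measure Y) = P ∘ₘ (Q₀ : Measure (X × Z)).snd := by
    refine tendsto_comp_of_continuous hSc hP
      (ProbabilityMeasure.tendsto_map_of_tendsto_of_continuous _ _ hlim continuous_snd)
      ((PtSpace.continuous_val.tendsto ν₀).comp (hν.comp hφ.tendsto_atTop)) fun n => ?_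
    change ((ν (φ n)).1 : Measure Y) = P ∘ₘ (Q (φ n) : Measure (X × Z)).snd
    rw [hQsnd]
    refine (comp_snd_map_eq (hπ _) (hξm _) ((hξ _).mono fun x hx => ?_)).symm
    rw [hP, hx]
  let cost (e : X × Z) : ℝ≥0∞ := C e.1 (S e.2).1
  have hcost : LowerSemicontinuous cost :=
    LowerSemicontinuous.comp hlsc (continuous_fst.prodMk (hSc.comp continuous_snd))
  have hQ₀cost : ∫⁻ e, cost e ∂(Q₀ : Measure (X × Z)) ≤ c := by
    refine (lintegral_le_liminf_lintegral_of_lowerSemicontinuous hlim hcost).trans ?_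
    refine liminf_le_of_le (by isBoundedDefault) fun b hb => ?_
    obtain ⟨n, hn⟩ := hb.exists
    refine hn.trans (le_trans (le_of_eq ?_) (hc (φ n)))
    rw [hQ, lintegral_map hcost.measurable (hpair _)]
    exact lintegral_congr_ae ((hξ _).mono fun x hx => by simp only [cost, hx])
  let κ := (Q₀ : Measure (X × Z)).condKernel
  let π₀ : ProbabilityMeasure (X × Y) := ⟨(μ₀ : Measure X) ⊗ₘ (P ∘ₖ κ), inferInstance⟩
  have hπ₀ : (π₀ : Measure (X × Y)) = (μ₀ : Measure X) ⊗ₘ (P ∘ₖ κ) := rfl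
  have hfst : (π₀ : Measure (X × Y)).fst = μ₀ := by rw [hπ₀, Measure.fst_compProd]
  have hsnd : (π₀ : Measure (X × Y)).snd = ν₀.1 := by
    rw [hπ₀, Measure.snd_compProd, ← Measure.comp_assoc, hν₀, ← hQ₀]
    have : κ ∘ₘ (Q₀ : Measure (X × Z)).fst = (Q₀ : Measure (X × Z)).snd := by
      rw [← Measure.snd_compProd]
      exact congrArg Measure.snd ((Q₀ : Measure (X × Z)).disintegrate κ)
    rw [this]
  refine ⟨π₀, ⟨hfst, hsnd⟩, ?_⟩
  have hdis : ∀ᵐ x ∂(μ₀ : Measure X), (disint π₀ x : Measure Y) = P ∘ₘ κ x := by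
    have := eq_condKernel_of_measure_eq_compProd (ρ := (π₀ : Measure (X × Y))) (P ∘ₖ κ)
      (by rw [hfst]; exact hπ₀)
    rw [hfst] at this
    filter_upwards [this] with x hx
    rw [← Kernel.comp_apply, hx]
    rfl
  have hmem : ∀ᵐ x ∂(μ₀ : Measure X), MemPt t (disint π₀ x) := by
    have hgm : Measurable fun y => (growth t y₀ y : ℝ≥0∞) := by
      have := (continuous_growth (by linarith : 0 ≤ t) y₀).measurable
      fun_prop
    have h1 : ∫⁻ x, ∫⁻ y, growth t y₀ y ∂(π₀ : Measure (X × Y)).condKernel x ∂(μ₀ : Measure X) =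
        ∫⁻ y, growth t y₀ y ∂(ν₀.1 : Measure Y) := by
      rw [← hsnd, ← hfst, Measure.snd, lintegral_map hgm measurable_snd]
      exact Measure.lintegral_condKernel (hgm.comp measurable_snd)
    filter_upwards [ae_lt_top hgm.lintegral_kernel
      (h1.trans_ne ((memPt_iff_lintegral_growth ht y₀).1 ν₀.2))] with x hx
    exact (memPt_iff_lintegral_growth ht y₀).2 hx.ne
  calc weakCost C μ₀ π₀ ≤ ∫⁻ x, ∫⁻ z, cost (x, z) ∂κ x ∂(μ₀ : Measure X) := by
        refine lintegral_mono_ae ?_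
        filter_upwards [hdis, hmem] with x hx1 hx2
        exact le_lintegral_of_lowerSemicontinuous_of_convex ht
          (LowerSemicontinuous.comp (g := fun p => (x, p)) hlsc (Continuous.prodMk_right x))
          (hconv x) hP
          (LowerSemicontinuous.comp hcost (Continuous.prodMk_right x)).measurable
          (q := ⟨_, hx2⟩) hx1
    _ = ∫⁻ e, cost e ∂(Q₀ : Measure (X × Z)) := by
        rw [← hQ₀]
        exact Measure.lintegral_condKernel hcost.measurable
    _ ≤ c := hQ₀cost


/-- The weak transport value `(μ, ν) ↦ V_C(μ, ν)` is jointly lower semicontinuous, where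
`𝒫(X)` carries the weak topology and `𝒫_t(Y)` the `t`-Wasserstein topology. -/
theorem weak_transport_value_lowerSemicontinuous
    (t : ℝ) (ht : 1 ≤ t) (C : X → ProbabilityMeasure Y → ℝ≥0∞)
    (hlsc : LowerSemicontinuous fun q : X × PtSpace t Y => C q.1 q.2.1)
    (hconv : ∀ x : X, ∀ p q r : ProbabilityMeasure Y, MemPt t p → MemPt t q →
      ∀ a b : ℝ≥0, a + b = 1 →
      (r : Measure Y) = (a : ℝ≥0∞) • (p : Measure Y) + (b : ℝ≥0∞) • (q : Measure Y) →
      C x r ≤ (a : ℝ≥0∞) * C x p + (b : ℝ≥0∞) * C x q) :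
    LowerSemicontinuous
      (fun q : ProbabilityMeasure X × PtSpace t Y => weakValue C q.1 q.2.1) := by
  have := PtSpace.metrizableSpace (Y := Y) ht
  intro q₀ y hy
  obtain ⟨c, hyc, hc⟩ := exists_between hy
  by_contra h
  rw [Filter.not_eventually] at h
  obtain ⟨q, hq, hqy⟩ := Filter.exists_seq_forall_of_frequently h
  have hπ (n : ℕ) : ∃ π, IsCoupling (q n).1 (q n).2.1 π ∧ weakCost C (q n).1 π ≤ c := by
    have : weakValue C (q n).1 (q n).2.1 < c := (not_lt.1 (hqy n)).trans_lt hyc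
    simp only [weakValue, iInf_lt_iff] at this
    obtain ⟨π, hπ, hπc⟩ := this
    exact ⟨π, hπ, hπc.le⟩
  choose π hπ hπc using hπ
  obtain ⟨π₀, hπ₀, hle⟩ := exists_isCoupling_weakCost_le_of_tendsto ht hlsc hconv
    ((continuous_fst.tendsto q₀).comp hq) ((continuous_snd.tendsto q₀).comp hq) hπ hπc
  exact absurd ((iInf₂_le π₀ hπ₀).trans hle) (not_le.2 hc)

end
end
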